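/- arXiv:1302.1124 — 2 statements merged into one kernel-verified Lean document; each statement's English description precedes it below -/
import Mathlib

section
/- Let (R, m) be a complete regular local ring of prime characteristic p, let M be an Artinian R-module, and let Θ : M → M be an e-th Frobenius map for some e ≥ 1. Then there exists an integer n ≥ 0 such that Θ^n x = 0 for every x in Nil(M) = { x ∈ M : Θ^i x = 0 for some i ≥ 0 }; equivalently, the ascending chain of R-submodules M_i = { x ∈ M : Θ^i x = 0 } stabilises. -/
/-- A Noetherian local ring is *regular* if its maximal ideal can be generated by
`dim R` elements (equivalently, the minimal number of generators of the maximal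
ideal equals the Krull dimension). -/
def IsRegularLocal (R : Type*) [CommRing R] [IsLocalRing R] : Prop :=
  ∃ s : Finset R, Ideal.span (s : Set R) = IsLocalRing.maximalIdeal R ∧
    (s.card : WithBot (WithTop ℕ)) = ringKrullDim R


lemma hsl_artin_of_ker {P G : Type*} [CommRing P] [AddCommGroup G] [Module P G] (X : P)
    (hloc : ∀ g : G, ∃ n : ℕ, X ^ n • g = 0)
    (hA : IsArtinian P (LinearMap.ker (LinearMap.lsmul P G X))) : IsArtinian P G := by
  rw [← monotone_stabilizes_iff_artinian]
  intro f
  let B : ℕ → Submodule P G := fun j => OrderDual.ofDual (f j)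
  have hB : ∀ i j, i ≤ j → B j ≤ B i := fun i j hij => f.monotone hij
  let L : ℕ → ℕ → Submodule P (LinearMap.ker (LinearMap.lsmul P G X)) := fun n j =>
    ((B j ⊓ LinearMap.ker (LinearMap.lsmul P G (X ^ (n+1)))).map
      (LinearMap.lsmul P G (X ^ n))).comap (Submodule.subtype _)
  have hL : ∀ n j (u : LinearMap.ker (LinearMap.lsmul P G X)),
      u ∈ L n j ↔ ∃ b ∈ B j, X ^ (n+1) • b = 0 ∧ X ^ n • b = u.1 := by
    intro n j u
    simp [L, and_assoc]
  have hLj : ∀ n i j, i ≤ j → L n j ≤ L n i := by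
    intro n i j hij u hu
    rw [hL] at hu ⊢
    obtain ⟨b, hb, h⟩ := hu
    exact ⟨b, hB i j hij hb, h⟩
  have hLn1 : ∀ j n, L (n+1) j ≤ L n j := by
    intro j n u hu
    rw [hL] at hu ⊢
    obtain ⟨b, hb, h1, h2⟩ := hu
    refine ⟨X • b, Submodule.smul_mem _ _ hb, ?_, ?_⟩
    · rw [← mul_smul, ← pow_succ]; exact h1
    · rw [← mul_smul, ← pow_succ]; exact h2
  have hLn : ∀ j, Antitone (fun n => L n j) := fun j => antitone_nat_of_succ_le (hLn1 j)
  have stab : ∀ g : ℕ → Submodule P (LinearMap.ker (LinearMap.lsmul P G X)), Antitone g →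
      ∃ n, ∀ m, n ≤ m → g n = g m := by
    intro g hg
    exact (monotone_stabilizes_iff_artinian.2 hA) ⟨fun n => OrderDual.toDual (g n), fun a b h => hg h⟩
  obtain ⟨N, hN⟩ := stab (fun j => L j j) (fun a b h => (hLj b a b h).trans (hLn a h))
  choose c hc using fun n => stab (fun j => L n j) (fun a b h => hLj n a b h)
  let J := N + ∑ n ∈ Finset.range N, c n
  have key : ∀ j, J ≤ j → ∀ n, L n J ≤ L n j := by
    intro j hj n
    by_cases hn : n < N
    · have h1 : c n ≤ J := (Finset.single_le_sum (f := c) (fun _ _ => Nat.zero_le _)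
        (Finset.mem_range.2 hn)).trans (Nat.le_add_left _ _)
      have e1 := hc n J h1
      have e2 := hc n j (h1.trans hj)
      beta_reduce at e1 e2
      exact (e1.symm.trans e2).le
    · push Not at hn
      have hJ : N ≤ J := Nat.le_add_right _ _
      have e := hN (max n j) (hn.trans (le_max_left _ _))
      beta_reduce at e
      calc L n J ≤ L N J := hLn J hn
        _ ≤ L N N := hLj N _ _ hJ
        _ = _ := e
        _ ≤ L (max n j) j := hLj _ _ _ (le_max_right _ _)
        _ ≤ L n j := hLn j (le_max_left _ _)
  refine ⟨J, fun j hj => ?_⟩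
  change B J = B j
  refine le_antisymm ?_ (hB _ _ hj)
  have main : ∀ n, ∀ b ∈ B J, X ^ n • b = 0 → b ∈ B j := by
    intro n
    induction n with
    | zero => intro b _ h; simp at h; simp [h]
    | succ n ih =>
      intro b hb h
      have hk : X ^ n • b ∈ LinearMap.ker (LinearMap.lsmul P G X) := by
        simp only [LinearMap.mem_ker, LinearMap.lsmul_apply]
        rw [← mul_smul, ← pow_succ']; exact h
      have := key j hj n ((hL n J ⟨_, hk⟩).2 ⟨b, hb, h, rfl⟩)
      obtain ⟨b', hb', h1, h2⟩ := (hL _ _ _).1 this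
      have h3 := ih (b - b') (Submodule.sub_mem _ hb (hB _ _ hj hb')) (by
        rw [smul_sub, h2]; simp)
      have := Submodule.add_mem _ h3 hb'
      simpa using this
  intro b hb
  obtain ⟨n, hn⟩ := hloc b
  exact main n b hb hn

lemma hsl_artin_of_list {P G : Type*} [CommRing P] [AddCommGroup G] [Module P G] (l : List P)
    (hloc : ∀ X ∈ l, ∀ g : G, ∃ n : ℕ, X ^ n • g = 0) : ∀ (N : Submodule P G),
    (∃ K : Submodule P G, IsArtinian P K ∧ ∀ g ∈ N, (∀ X ∈ l, X • g = 0) → g ∈ K) →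
      IsArtinian P N := by
  induction l with
  | nil =>
    rintro N ⟨K, hK, h⟩
    exact isArtinian_of_le (fun g hg => h g hg (by simp))
  | cons a l ih =>
    rintro N ⟨K, hK, h⟩
    have h1 : IsArtinian P (N ⊓ LinearMap.ker (LinearMap.lsmul P G a) : Submodule P G) := by
      apply ih (fun X hX => hloc X (List.mem_cons_of_mem _ hX))
      refine ⟨K, hK, fun g hg hl => h g hg.1 ?_⟩
      intro X hX
      rcases List.mem_cons.1 hX with rfl | hX
      · simpa using hg.2
      · exact hl X hX
    apply hsl_artin_of_ker a
    · intro g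
      obtain ⟨n, hn⟩ := hloc a (by simp) g.1
      exact ⟨n, Subtype.ext hn⟩
    · let F : (LinearMap.ker (LinearMap.lsmul P N a)) →ₗ[P]
          (N ⊓ LinearMap.ker (LinearMap.lsmul P G a) : Submodule P G) :=
        LinearMap.codRestrict _ (N.subtype ∘ₗ Submodule.subtype _) (by
          rintro ⟨⟨g, hg⟩, hk⟩
          refine ⟨hg, ?_⟩
          have := congrArg Subtype.val (LinearMap.mem_ker.1 hk)
          simpa using this)
      apply isArtinian_of_injective F
      intro u v huv
      apply Subtype.ext; apply Subtype.ext
      have h := congrArg Subtype.val huv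
      exact h

open Polynomial in
lemma hsl_aeval_coeff {S A : Type*} [CommRing S] [AddCommGroup A] [Module S A]
    (p : S[X]) (f : ℕ →₀ A) (t : ℕ) :
    ((aeval (R := S) (Finsupp.lcomapDomain (R := S) (M := A) (fun n : ℕ => n + 1)
      (add_left_injective 1) : Module.End S (ℕ →₀ A)) p) f) t =
      ∑ i ∈ p.support, p.coeff i • f (t + i) := by
  have hT : ∀ (i : ℕ) (f : ℕ →₀ A) (t : ℕ), (((Finsupp.lcomapDomain (R := S) (M := A)
      (fun n : ℕ => n + 1) (add_left_injective 1) : Module.End S (ℕ →₀ A)) ^ i) f) t = f (t + i) := by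
    intro i
    induction i with
    | zero => intro f t; simp
    | succ i ih =>
      intro f t
      rw [pow_succ, Module.End.mul_apply, ih]
      simp [Finsupp.lcomapDomain, Finsupp.comapDomain_apply, add_assoc]
  rw [aeval_def, eval₂_eq_sum, sum_def]
  simp [LinearMap.sum_apply, Finsupp.finsetSum_apply, hT]

set_option maxHeartbeats 1000000 in
/-- Dual form of the Artin-Rees lemma. -/
lemma hsl_dual_artin_rees {S A : Type*} [CommRing S] [AddCommGroup A] [Module S A]
    [IsArtinian S A] (J : Ideal S) (hJ : J.FG) (K : Submodule S A) :
    ∃ c : ℕ, ∀ t, c ≤ t → ∀ u : A, (∀ r ∈ J ^ (t - c), r • u ∈ K) →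
      ∃ k ∈ K, ∃ a : A, (∀ r ∈ J ^ t, r • a = 0) ∧ u = k + a := by
  classical
  let T : Module.End S (ℕ →₀ A) := Finsupp.lcomapDomain (R := S) (M := A) (fun n : ℕ => n + 1)
      (add_left_injective 1)
  let G := Module.AEval S (ℕ →₀ A) T
  let P := reesAlgebra J
  let co : G → ℕ → A := fun g t => ((Module.AEval.of S (ℕ →₀ A) T).symm g) t
  have hco : ∀ (x : P) (g : G) t, co (x • g) t = ∑ i ∈ x.1.support, x.1.coeff i • co g (t + i) := by
    intro x g t
    exact hsl_aeval_coeff x.1 _ t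
  have hco_add : ∀ (g h : G) t, co (g + h) t = co g t + co h t := by
    intro g h t
    simp [co]
  have hco_zero : ∀ t, co 0 t = 0 := by
    intro t; simp [co]
  -- graded submodules
  let sub : (w : ℕ → Submodule S A) → (∀ i t, ∀ r ∈ J ^ i, ∀ u ∈ w (t + i), r • u ∈ w t) →
      Submodule P G := fun w hw =>
    { carrier := {g | ∀ t, co g t ∈ w t}
      add_mem' := fun {g h} hg hh t => by rw [hco_add]; exact Submodule.add_mem _ (hg t) (hh t)
      zero_mem' := fun t => by rw [hco_zero]; exact Submodule.zero_mem _
      smul_mem' := fun x g hg t => by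
        rw [hco]
        refine Submodule.sum_mem _ fun i _ => hw i t _ ((mem_reesAlgebra_iff J _).1 x.2 i) _ (hg _) }
  have hsub : ∀ w hw g, g ∈ sub w hw ↔ ∀ t, co g t ∈ w t := fun w hw g => Iff.rfl
  let At : ℕ → Submodule S A := fun t => Submodule.torsionBySet S A (J ^ t : Ideal S)
  have hAt : ∀ t u, u ∈ At t ↔ ∀ r ∈ J ^ t, r • u = 0 := by
    intro t u
    simp [At, Submodule.mem_torsionBySet_iff]
  have hAt1 : ∀ i t, ∀ r ∈ J ^ i, ∀ u ∈ At (t + i), r • u ∈ At t := by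
    intro i t r hr u hu
    rw [hAt] at hu ⊢
    intro s hs
    rw [← mul_smul]
    exact hu _ (by rw [pow_add]; exact Ideal.mul_mem_mul hs hr)
  let Z := sub At hAt1
  have hD : IsArtinian P (G ⧸ Z) := by
    obtain ⟨s, hs⟩ := hJ
    have hsJ : ∀ y ∈ s, y ∈ J := fun y hy => hs ▸ Submodule.subset_span hy
    let l : List P := s.attach.toList.map
      (fun y => (⟨Polynomial.monomial 1 y.1, by
        rw [reesAlgebra.monomial_mem, pow_one]; exact hsJ _ y.2⟩ : P))
    have hl : ∀ y ∈ s, ∃ X ∈ l, X.1 = Polynomial.monomial 1 y := by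
      intro y hy
      exact ⟨_, List.mem_map.2 ⟨⟨y, hy⟩, by simp, rfl⟩, rfl⟩
    have hl' : ∀ X ∈ l, ∃ y ∈ s, X.1 = Polynomial.monomial 1 y := by
      intro X hX
      obtain ⟨y, _, rfl⟩ := List.mem_map.1 hX
      exact ⟨y.1, y.2, rfl⟩
    have hmono : ∀ (x : P) (n : ℕ) (y : S), x.1 = Polynomial.monomial n y → ∀ (g : G) t,
        co (x • g) t = y • co g (t + n) := by
      intro x n y hx g t
      rw [hco, hx]
      by_cases hy : y = 0
      · simp [hy]
      · rw [Polynomial.support_monomial n hy]; simp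
    suffices h : IsArtinian P (⊤ : Submodule P (G ⧸ Z)) from
      isArtinian_of_linearEquiv Submodule.topEquiv
    apply hsl_artin_of_list l
    · intro X hX d
      obtain ⟨g, rfl⟩ := Submodule.Quotient.mk_surjective _ d
      obtain ⟨y, hy, hXy⟩ := hl' X hX
      let f := ((Module.AEval.of S (ℕ →₀ A) T).symm g)
      refine ⟨f.support.sup id + 1, ?_⟩
      rw [← Submodule.Quotient.mk_smul]
      rw [Submodule.Quotient.mk_eq_zero, hsub At hAt1]
      intro t
      rw [hmono _ (f.support.sup id + 1) (y ^ (f.support.sup id + 1))]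
      · have : f (t + (f.support.sup id + 1)) = 0 := by
          by_contra h
          have := Finset.le_sup (f := id) (Finsupp.mem_support_iff.2 h)
          simp only [id] at this
          omega
        change _ • f _ ∈ _
        rw [this]; simp
      · rw [SubmonoidClass.coe_pow, hXy, Polynomial.monomial_pow, one_mul]
    · let w0 : ℕ → Submodule S A := fun t => if t = 0 then ⊤ else At t
      have hw0 : ∀ i t, ∀ r ∈ J ^ i, ∀ u ∈ w0 (t + i), r • u ∈ w0 t := by
        intro i t r hr u hu
        by_cases h : t = 0
        · simp [w0, h]
        · have h' : t + i ≠ 0 := by omega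
          simp only [w0, h, h', if_false] at hu ⊢
          exact hAt1 i t r hr u hu
      let K0 : Submodule P (G ⧸ Z) := (sub w0 hw0).map Z.mkQ
      let sg : A →ₗ[S] G := (Module.AEval.of S (ℕ →₀ A) T).toLinearMap ∘ₗ (Finsupp.lsingle 0)
      have hsg0 : ∀ a, co (sg a) 0 = a := by intro a; simp [co, sg]
      have hsg1 : ∀ a t, t ≠ 0 → co (sg a) t = 0 := by
        intro a t ht; simp [co, sg, ht]
      let ι : A →ₗ[S] (G ⧸ Z) := (Z.mkQ.restrictScalars S) ∘ₗ sg
      have hιm : ∀ a, ι a ∈ K0.restrictScalars S := by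
        intro a
        refine ⟨sg a, ?_, rfl⟩
        intro t
        by_cases h : t = 0
        · simp [w0, h]
        · rw [hsg1 a t h]; exact Submodule.zero_mem _
      refine ⟨K0, ?_, ?_⟩
      · have : IsArtinian S (K0.restrictScalars S) := by
          apply isArtinian_of_surjective A (ι.codRestrict (K0.restrictScalars S) hιm)
          rintro ⟨d, ⟨g, hg, rfl⟩⟩
          refine ⟨co g 0, Subtype.ext ?_⟩
          change Submodule.Quotient.mk (sg (co g 0)) = Submodule.Quotient.mk g
          rw [eq_comm, Submodule.Quotient.eq, hsub At hAt1]
          intro t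
          have hneg : co (g - sg (co g 0)) t = co g t - co (sg (co g 0)) t := by simp [co]
          rw [hneg]
          by_cases h : t = 0
          · subst h; rw [hsg0]; simp
          · rw [hsg1 _ t h, sub_zero]
            have := hg t
            simpa [w0, h] using this
        have hst : IsScalarTower S P K0 := inferInstance
        have h2 : @IsArtinian S K0 _ _ _ := this
        exact isArtinian_of_tower S h2
      · intro d _ hd
        obtain ⟨g, rfl⟩ := Submodule.Quotient.mk_surjective _ d
        refine ⟨g, ?_, rfl⟩
        have h1 : ∀ y ∈ s, ∀ t, y • co g (t + 1) ∈ At t := by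
          intro y hy t
          obtain ⟨X, hX, hXy⟩ := hl y hy
          have := hd X hX
          rw [← Submodule.Quotient.mk_smul, Submodule.Quotient.mk_eq_zero, hsub At hAt1] at this
          have := this t
          rwa [hmono X 1 y hXy] at this
        intro t
        rcases t with _ | t
        · simp [w0]
        · simp only [w0, Nat.succ_ne_zero, if_false]
          have h2 : ∀ y ∈ J, y • co g (t + 1) ∈ At t := by
            intro y hy
            rw [← hs] at hy
            have hle : Submodule.span S (s : Set S) ≤
                (At t).comap (LinearMap.toSpanSingleton S A (co g (t + 1))) := by
              rw [Submodule.span_le]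
              intro y hy
              exact h1 y hy t
            exact hle hy
          rw [hAt]
          intro r hr
          rw [pow_succ] at hr
          refine Submodule.mul_induction_on hr ?_ ?_
          · intro a ha b hb
            rw [mul_smul]
            exact (hAt _ _).1 (h2 b hb) a ha
          · intro a b ha hb
            rw [add_smul, ha, hb, add_zero]
  -- the chain
  let w : ℕ → ℕ → Submodule S A := fun s t =>
    { carrier := {u | ∀ j, j ≤ s → j ≤ t → ∀ r ∈ J ^ (t - j), r • u ∈ K ⊔ At j}
      add_mem' := fun {a b} ha hb j h1 h2 r hr => by
        rw [smul_add]; exact Submodule.add_mem _ (ha j h1 h2 r hr) (hb j h1 h2 r hr)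
      zero_mem' := fun j h1 h2 r hr => by simp
      smul_mem' := fun x u hu j h1 h2 r hr => by
        rw [smul_comm]; exact Submodule.smul_mem _ _ (hu j h1 h2 r hr) }
  have hw1 : ∀ s, ∀ i t, ∀ r ∈ J ^ i, ∀ u ∈ w s (t + i), r • u ∈ w s t := by
    intro s i t r hr u hu j h1 h2 r' hr'
    rw [← mul_smul]
    refine hu j h1 (by omega) _ ?_
    have : t + i - j = (t - j) + i := by omega
    rw [this, pow_add]
    exact Ideal.mul_mem_mul hr' hr
  let W : ℕ → Submodule P G := fun s => sub (w s) (hw1 s)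
  have hZW : ∀ s, Z ≤ W s := by
    intro s g hg t j h1 h2 r hr
    apply Submodule.mem_sup_right
    have h3 := hg t
    obtain ⟨i, rfl⟩ := Nat.exists_eq_add_of_le h2
    rw [Nat.add_sub_cancel_left] at hr
    exact hAt1 i j r hr _ h3
  have hWanti : ∀ a b, a ≤ b → W b ≤ W a := by
    intro a b hab g hg t j h1 h2 r hr
    exact hg t j (h1.trans hab) h2 r hr
  obtain ⟨c, hc⟩ := (monotone_stabilizes_iff_artinian.2 hD)
    ⟨fun n => OrderDual.toDual ((W n).map Z.mkQ), fun a b h => Submodule.map_mono (hWanti a b h)⟩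
  refine ⟨c, fun t ht u hu => ?_⟩
  have hct : (W c).map Z.mkQ = (W t).map Z.mkQ := hc t ht
  have hle : W c ≤ W t := by
    intro g hg
    have : Z.mkQ g ∈ (W t).map Z.mkQ := by
      rw [← hct]; exact ⟨g, hg, rfl⟩
    obtain ⟨g', hg', e⟩ := this
    have h3 : g - g' ∈ Z := (Submodule.Quotient.eq _).1 e.symm
    have := Submodule.add_mem _ (hZW t h3) hg'
    simpa using this
  let g : G := Module.AEval.of S (ℕ →₀ A) T (Finsupp.single t u)
  have hg1 : co g t = u := by simp [co, g]
  have hg2 : ∀ t', t' ≠ t → co g t' = 0 := by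
    intro t' h; simp [co, g, h]
  have hgc : g ∈ W c := by
    intro t'
    by_cases h : t' = t
    · subst h
      rw [hg1]
      intro j h1 h2 r hr
      apply Submodule.mem_sup_left
      have e : t' - j = (c - j) + (t' - c) := by omega
      rw [e, pow_add] at hr
      refine Submodule.mul_induction_on hr ?_ ?_
      · intro a ha b hb
        rw [mul_smul]
        exact Submodule.smul_mem _ _ (hu b hb)
      · intro a b ha hb
        rw [add_smul]; exact Submodule.add_mem _ ha hb
    · rw [hg2 t' h]; exact Submodule.zero_mem _
  have h4 := hle hgc t t le_rfl le_rfl 1 (by simp)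
  rw [hg1, one_smul] at h4
  obtain ⟨k, hk, a, ha, e⟩ := Submodule.mem_sup.1 h4
  exact ⟨k, hk, a, (hAt _ _).1 ha, e.symm⟩

open TensorProduct in
lemma hsl_koszul {R S T : Type*} [CommRing R] [CommRing S] [Algebra R S] [AddCommGroup T]
    [Module R T] (n : ℕ) (x : ℕ → R)
    (hreg : ∀ k < n, ∀ (r : S) (a : ℕ → S), algebraMap R S (x k) * r =
        ∑ i ∈ Finset.range k, a i * algebraMap R S (x i) →
      ∃ b : ℕ → S, r = ∑ i ∈ Finset.range k, b i * algebraMap R S (x i))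
    (z : ℕ → T) (hz : ∀ i j, x i • z j = x j • z i) :
    ∀ k ≤ n, ∀ r : ℕ → S, ∑ i ∈ Finset.range k, r i * algebraMap R S (x i) = 0 →
      ∑ i ∈ Finset.range k, z i ⊗ₜ[R] r i = 0 := by
  intro k
  induction k with
  | zero => intro _ r _; simp
  | succ k ih =>
    intro hk r hr
    rw [Finset.sum_range_succ] at hr ⊢
    obtain ⟨b, hb⟩ := hreg k hk (r k) (fun i => - r i) (by
      simp only [neg_mul, Finset.sum_neg_distrib]
      linear_combination hr)
    have h1 := ih (by omega) (fun i => r i + b i * algebraMap R S (x k)) (by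
      rw [← hr, hb, Finset.sum_mul, ← Finset.sum_add_distrib]
      exact Finset.sum_congr rfl fun i _ => by ring)
    have h2 : ∀ i, z i ⊗ₜ[R] (b i * algebraMap R S (x k)) =
        z k ⊗ₜ[R] (b i * algebraMap R S (x i)) := by
      intro i
      have e : ∀ j, b i * algebraMap R S (x j) = x j • b i := by
        intro j; rw [Algebra.smul_def, mul_comm]
      rw [e, e, ← TensorProduct.smul_tmul, ← TensorProduct.smul_tmul, hz]
    rw [hb, TensorProduct.tmul_sum, ← Finset.sum_add_distrib, ← h1]
    refine Finset.sum_congr rfl fun i _ => ?_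
    rw [TensorProduct.tmul_add, h2]

open TensorProduct in
lemma hsl_max_inj {R S : Type*} [CommRing R] [CommRing S] [Algebra R S] (m : Ideal R)
    (n : ℕ) (x : ℕ → R) (hxm : ∀ i, x i ∈ m)
    (hspan : ∀ a ∈ m, ∃ b : ℕ → R, a = ∑ i ∈ Finset.range n, b i * x i)
    (hreg : ∀ k < n, ∀ (r : S) (a : ℕ → S), algebraMap R S (x k) * r =
        ∑ i ∈ Finset.range k, a i * algebraMap R S (x i) →
      ∃ b : ℕ → S, r = ∑ i ∈ Finset.range k, b i * algebraMap R S (x i)) :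
    Function.Injective (LinearMap.rTensor S m.subtype) := by
  rw [injective_iff_map_eq_zero]
  intro w hw
  have h1 : ∃ r : ℕ → S, w = ∑ i ∈ Finset.range n, (⟨x i, hxm i⟩ : m) ⊗ₜ[R] r i := by
    clear hw
    induction w using TensorProduct.induction_on with
    | zero => exact ⟨0, by simp⟩
    | tmul a s =>
      obtain ⟨b, hb⟩ := hspan a.1 a.2
      refine ⟨fun i => b i • s, ?_⟩
      have : a = ∑ i ∈ Finset.range n, b i • (⟨x i, hxm i⟩ : m) := by
        apply Subtype.ext
        rw [hb]; simp
      rw [this, TensorProduct.sum_tmul]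
      exact Finset.sum_congr rfl fun i _ => TensorProduct.smul_tmul _ _ _
    | add u v hu hv =>
      obtain ⟨r, rfl⟩ := hu
      obtain ⟨r', rfl⟩ := hv
      exact ⟨fun i => r i + r' i, by simp [TensorProduct.tmul_add, Finset.sum_add_distrib]⟩
  obtain ⟨r, rfl⟩ := h1
  apply hsl_koszul n x hreg
  · intro i j
    apply Subtype.ext
    simp [mul_comm]
  · exact le_rfl
  · have := congrArg (TensorProduct.lid R S) hw
    simp only [map_sum, LinearMap.rTensor_tmul, Submodule.subtype_apply, TensorProduct.lid_tmul,
      map_zero, Algebra.smul_def] at this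
    rw [← this]
    exact Finset.sum_congr rfl fun i _ => by ring

open TensorProduct in
lemma hsl_step_inj {R S N : Type*} [CommRing R] [IsLocalRing R] [CommRing S] [Algebra R S]
    [AddCommGroup N] [Module R N]
    (hm : Function.Injective (LinearMap.rTensor S (IsLocalRing.maximalIdeal R).subtype))
    (Q : Submodule R N) (q : N) (hq : q ∉ Q) (hmq : ∀ a ∈ IsLocalRing.maximalIdeal R, a • q ∈ Q)
    (Q' : Submodule R N) (hQQ' : Q ≤ Q') (hQ' : Q' = Q ⊔ Submodule.span R {q}) :
    Function.Injective (LinearMap.rTensor S (Submodule.inclusion hQQ')) := by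
  have hqQ' : q ∈ Q' := by
    rw [hQ']; exact Submodule.mem_sup_right (Submodule.mem_span_singleton_self q)
  let α1 : IsLocalRing.maximalIdeal R →ₗ[R] Q :=
    LinearMap.codRestrict Q ((LinearMap.toSpanSingleton R N q) ∘ₗ Submodule.subtype _)
      (fun a => hmq a.1 a.2)
  let α : IsLocalRing.maximalIdeal R →ₗ[R] Q × R :=
    LinearMap.prod α1 (-(Submodule.subtype _))
  let β : Q × R →ₗ[R] Q' :=
    LinearMap.coprod (Submodule.inclusion hQQ') (LinearMap.toSpanSingleton R Q' ⟨q, hqQ'⟩)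
  have hex : Function.Exact α β := by
    rintro ⟨⟨u, hu⟩, r⟩
    constructor
    · intro h
      have h1 : u + r • q = 0 := by
        have := congrArg Subtype.val h
        simpa [β] using this
      have hr : r ∈ IsLocalRing.maximalIdeal R := by
        rw [IsLocalRing.mem_maximalIdeal]
        intro hru
        apply hq
        obtain ⟨v, rfl⟩ := hru
        have : q = -((↑v⁻¹ : R) • u) := by
          rw [eq_neg_of_add_eq_zero_left h1, smul_neg, neg_neg, ← mul_smul]; simp
        rw [this]
        exact Submodule.neg_mem _ (Submodule.smul_mem _ _ hu)
      refine ⟨-⟨r, hr⟩, ?_⟩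
      apply Prod.ext
      · apply Subtype.ext
        simp [α, α1]
        exact (eq_neg_of_add_eq_zero_left h1).symm
      · simp [α]
    · rintro ⟨a, ha⟩
      rw [← ha]
      apply Subtype.ext
      change (a.1 • q) + (-a.1) • q = 0
      simp
  have hsurj : Function.Surjective β := by
    rintro ⟨v, hv⟩
    rw [hQ', Submodule.mem_sup] at hv
    obtain ⟨u, hu, w, hw, rfl⟩ := hv
    obtain ⟨r, rfl⟩ := Submodule.mem_span_singleton.1 hw
    exact ⟨(⟨u, hu⟩, r), Subtype.ext (by simp [β])⟩
  have hex' := rTensor_exact S hex hsurj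
  rw [injective_iff_map_eq_zero]
  intro z hz
  have h1 : LinearMap.rTensor S β (LinearMap.rTensor S (LinearMap.inl R Q R) z) = 0 := by
    rw [← LinearMap.comp_apply, ← LinearMap.rTensor_comp]
    rw [← hz]; congr 2
    ext; simp [β]
  obtain ⟨w, hw⟩ := (hex' _).1 h1
  have h2 : LinearMap.rTensor S (IsLocalRing.maximalIdeal R).subtype w = 0 := by
    have h3 := congrArg (LinearMap.rTensor S (LinearMap.snd R Q R)) hw
    rw [← LinearMap.comp_apply, ← LinearMap.rTensor_comp, ← LinearMap.comp_apply,
      ← LinearMap.rTensor_comp] at h3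
    have e1 : LinearMap.snd R Q R ∘ₗ α = -(Submodule.subtype _) := by ext; simp [α]
    have e2 : LinearMap.snd R Q R ∘ₗ LinearMap.inl R Q R = 0 := by ext; simp
    rw [e1, e2, LinearMap.rTensor_neg] at h3
    simpa using h3
  have hw0 : w = 0 := hm (by rw [h2, map_zero])
  rw [hw0, map_zero] at hw
  have h3 := congrArg (LinearMap.rTensor S (LinearMap.fst R Q R)) hw
  rw [← LinearMap.comp_apply, ← LinearMap.rTensor_comp] at h3
  simpa using h3.symm

open TensorProduct in
/-- Flatness on torsion modules. -/
lemma hsl_tors_inj_fg {R S N : Type*} [CommRing R] [IsLocalRing R] [CommRing S] [Algebra R S]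
    [AddCommGroup N] [Module R N]
    (hm : Function.Injective (LinearMap.rTensor S (IsLocalRing.maximalIdeal R).subtype))
    (hN : ∀ x : N, ∃ k : ℕ, ∀ r ∈ (IsLocalRing.maximalIdeal R) ^ k, r • x = 0)
    (Q Q' : Submodule R N) (hQQ' : Q ≤ Q') [IsNoetherian R Q'] :
    Function.Injective (LinearMap.rTensor S (Submodule.inclusion hQQ')) := by
  rw [injective_iff_map_eq_zero]
  intro z hz
  by_contra hz0
  let good : Set (Submodule R Q') := {W | ∃ h : Q ≤ W.map Q'.subtype,
    LinearMap.rTensor S (Submodule.inclusion h) z ≠ 0}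
  have hne : good.Nonempty := by
    refine ⟨Q.comap Q'.subtype, ?_⟩
    have hQ : (Q.comap Q'.subtype).map Q'.subtype = Q := by
      rw [Submodule.map_comap_subtype]; exact inf_eq_right.2 hQQ'
    refine ⟨hQ.ge, fun h0 => hz0 ?_⟩
    have := congrArg (LinearMap.rTensor S (Submodule.inclusion hQ.le)) h0
    rw [← LinearMap.comp_apply, ← LinearMap.rTensor_comp] at this
    have e : Submodule.inclusion hQ.le ∘ₗ Submodule.inclusion hQ.ge = LinearMap.id := by
      ext; simp
    rw [e] at this
    simpa using this
  obtain ⟨W, ⟨hQW, hW⟩, hmax⟩ := set_has_maximal_iff_noetherian.2 ‹IsNoetherian R Q'› good hne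
  set W1 := W.map Q'.subtype with hW1
  have hW1Q' : W1 ≤ Q' := Submodule.map_subtype_le _ _
  by_cases hEq : Q' ≤ W1
  · apply hW
    have := congrArg (LinearMap.rTensor S (Submodule.inclusion hEq)) hz
    rw [← LinearMap.comp_apply, ← LinearMap.rTensor_comp] at this
    rw [map_zero] at this
    exact this
  · -- find q
    have hex : ∃ q ∈ Q', q ∉ W1 ∧ ∀ a ∈ IsLocalRing.maximalIdeal R, a • q ∈ W1 := by
      obtain ⟨y, hy, hyW⟩ := Set.not_subset.1 hEq
      have hk : ∃ k : ℕ, ∀ r ∈ (IsLocalRing.maximalIdeal R) ^ k, r • y ∈ W1 := by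
        obtain ⟨k, hk⟩ := hN y
        exact ⟨k, fun r hr => by rw [hk r hr]; exact Submodule.zero_mem _⟩
      classical
      have hk0 : Nat.find hk ≠ 0 := by
        intro h0
        have := Nat.find_spec hk
        rw [h0] at this
        exact hyW (by simpa using this 1 (by simp))
      obtain ⟨k, hk1⟩ := Nat.exists_eq_succ_of_ne_zero hk0
      have hlt := Nat.find_min hk (m := k) (by omega)
      push Not at hlt
      obtain ⟨r, hr, hry⟩ := hlt
      refine ⟨r • y, Submodule.smul_mem _ _ hy, hry, fun a ha => ?_⟩
      rw [← mul_smul]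
      apply Nat.find_spec hk
      rw [hk1, pow_succ']
      exact Ideal.mul_mem_mul ha hr
    obtain ⟨q, hqQ', hqW, hmq⟩ := hex
    let V : Submodule R Q' := W ⊔ Submodule.span R {⟨q, hqQ'⟩}
    have hV1 : V.map Q'.subtype = W1 ⊔ Submodule.span R {q} := by
      simp [V, Submodule.map_sup, Submodule.map_span, hW1]
    have hWV : W1 ≤ V.map Q'.subtype := by rw [hV1]; exact le_sup_left
    have hinj := hsl_step_inj hm W1 q hqW hmq _ hWV hV1
    refine hmax V ⟨hQW.trans hWV, ?_⟩ ?_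
    · intro h0
      apply hW
      apply hinj
      rw [map_zero, ← h0, ← LinearMap.comp_apply, ← LinearMap.rTensor_comp]
      rfl
    · refine lt_of_le_of_ne le_sup_left (fun h => hqW ?_)
      have : (⟨q, hqQ'⟩ : Q') ∈ V := Submodule.mem_sup_right (Submodule.mem_span_singleton_self _)
      rw [← h] at this
      exact ⟨_, this, rfl⟩

open TensorProduct in
lemma hsl_tors_inj {R S N : Type*} [CommRing R] [IsLocalRing R] [IsNoetherianRing R]
    [CommRing S] [Algebra R S]
    [AddCommGroup N] [Module R N]
    (hm : Function.Injective (LinearMap.rTensor S (IsLocalRing.maximalIdeal R).subtype))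
    (hN : ∀ x : N, ∃ k : ℕ, ∀ r ∈ (IsLocalRing.maximalIdeal R) ^ k, r • x = 0)
    (Q : Submodule R N) :
    Function.Injective (LinearMap.rTensor S Q.subtype) := by
  rw [injective_iff_map_eq_zero]
  intro z hz
  obtain ⟨P, hP, t, rfl⟩ := TensorProduct.exists_of_fg z
  let P1 : Submodule R N := P.map Q.subtype
  have hP1 : P1.FG := hP.map _
  let j : P →ₗ[R] P1 := Q.subtype.submoduleMap P
  have hj : LinearMap.rTensor S P1.subtype (LinearMap.rTensor S j t) = 0 := by
    rw [← hz, ← LinearMap.comp_apply, ← LinearMap.rTensor_comp, ← LinearMap.comp_apply,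
      ← LinearMap.rTensor_comp]
    rfl
  obtain ⟨Q2, hPQ, hQ2, h0⟩ := TensorProduct.eq_zero_of_fg_of_subtype_eq_zero hP1 hj
  have : IsNoetherian R Q2 := isNoetherian_of_fg_of_noetherian _ hQ2
  have h1 : LinearMap.rTensor S j t = 0 := by
    apply hsl_tors_inj_fg hm hN P1 Q2 hPQ
    rw [h0, map_zero]
  have h2 : P1 ≤ Q := Submodule.map_subtype_le _ _
  have h3 : P.subtype = Submodule.inclusion h2 ∘ₗ j := by ext; rfl
  rw [h3, LinearMap.rTensor_comp, LinearMap.comp_apply, h1, map_zero]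

open TensorProduct in
lemma hsl_tors_ker {R S M : Type*} [CommRing R] [IsLocalRing R] [IsNoetherianRing R]
    [CommRing S] [Algebra R S]
    [AddCommGroup M] [Module R M]
    (hm : Function.Injective (LinearMap.rTensor S (IsLocalRing.maximalIdeal R).subtype))
    (hM : ∀ x : M, ∃ k : ℕ, ∀ r ∈ (IsLocalRing.maximalIdeal R) ^ k, r • x = 0)
    (I : Ideal R) (a : S ⊗[R] M) (ha : ∀ g ∈ I, algebraMap R S g • a = 0) :
    ∃ b, LinearMap.lTensor S (Submodule.torsionBySet R M I).subtype b = a := by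
  classical
  obtain ⟨s, hs⟩ := IsNoetherian.noetherian I
  let π : M →ₗ[R] (s → M) := LinearMap.pi (fun g => LinearMap.lsmul R M g.1)
  have hker : LinearMap.ker π = Submodule.torsionBySet R M I := by
    ext y
    rw [← hs]
    simp only [LinearMap.mem_ker, Submodule.mem_torsionBySet_iff]
    constructor
    · intro h
      have hle : Submodule.span R (s : Set R) ≤ LinearMap.ker (LinearMap.toSpanSingleton R M y) := by
        rw [Submodule.span_le]
        intro g hg
        exact congrFun h ⟨g, hg⟩
      rintro ⟨g, hg⟩
      exact hle hg
    · intro h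
      funext g
      exact h ⟨g.1, Submodule.subset_span g.2⟩
  have hN : ∀ x : (s → M), ∃ k : ℕ, ∀ r ∈ (IsLocalRing.maximalIdeal R) ^ k, r • x = 0 := by
    intro x
    choose k hk using fun g => hM (x g)
    refine ⟨∑ g, k g, fun r hr => funext fun g => hk g r ?_⟩
    exact Ideal.pow_le_pow_right (Finset.single_le_sum (f := k) (fun _ _ => Nat.zero_le _)
      (Finset.mem_univ g)) hr
  have hinj := (LinearMap.lTensor_inj_iff_rTensor_inj S _).2
    (hsl_tors_inj (S := S) hm hN (LinearMap.range π))
  have h0 : LinearMap.lTensor S π a = 0 := by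
    apply (TensorProduct.piRight R R S (fun _ : s => M)).injective
    rw [map_zero]
    funext g
    have h1 : ∀ a : S ⊗[R] M, (TensorProduct.piRight R R S (fun _ : s => M)) (LinearMap.lTensor S π a) g
        = algebraMap R S g.1 • a := by
      intro a
      induction a using TensorProduct.induction_on with
      | zero => simp
      | tmul c y => simp [π, TensorProduct.smul_tmul']
      | add u v hu hv => rw [map_add, map_add, Pi.add_apply, hu, hv, smul_add]
    rw [h1]
    exact ha g.1 (hs ▸ Submodule.subset_span g.2)
  have h2 : LinearMap.lTensor S π.rangeRestrict a = 0 := by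
    apply hinj
    rw [map_zero, ← LinearMap.comp_apply, ← LinearMap.lTensor_comp]
    exact h0
  have hex : Function.Exact (Submodule.torsionBySet R M I).subtype π.rangeRestrict := by
    intro y
    rw [← hker]
    simp [LinearMap.rangeRestrict, Subtype.ext_iff]
  exact (lTensor_exact S hex π.surjective_rangeRestrict a).1 h2

lemma hsl_spanFinrank_ofList {R : Type*} [CommRing R] (l : List R) :
    (Ideal.ofList l).spanFinrank ≤ l.length := by
  classical
  have h : Ideal.ofList l = Submodule.span R (l.toFinset : Set R) := by
    simp [Ideal.ofList, Ideal.span]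
  rw [h]
  refine (Submodule.spanFinrank_span_le_ncard_of_finite (Finset.finite_toSet _)).trans ?_
  rw [Set.ncard_coe_finset]
  exact List.toFinset_card_le l

lemma hsl_dim_le {R : Type*} [CommRing R] [IsLocalRing R] [IsNoetherianRing R] (l : List R)
    (hl : Ideal.ofList l = IsLocalRing.maximalIdeal R) : ringKrullDim R ≤ (l.length : ℕ) := by
  refine le_trans (ringKrullDim_le_spanFinrank_maximalIdeal (R := R)) ?_
  rw [← hl]
  exact_mod_cast hsl_spanFinrank_ofList l

lemma hsl_dim_quot {R : Type*} [CommRing R] [IsLocalRing R] [IsNoetherianRing R] (l : List R)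
    (hl : ∀ a ∈ l, a ∈ IsLocalRing.maximalIdeal R) (k : ℕ)
    (h : ((k + l.length : ℕ) : WithBot ℕ∞) ≤ ringKrullDim R) :
    (k : WithBot ℕ∞) ≤ ringKrullDim (R ⧸ Ideal.ofList l) := by
  have h1 : Ideal.ofList l ≤ IsLocalRing.maximalIdeal R := Ideal.span_le.2 hl
  have h2 := ringKrullDim_le_ringKrullDim_quotient_add_spanFinrank (Ideal.ofList l)
    (by rwa [IsLocalRing.ringJacobson_eq_maximalIdeal])
  have h3 := h.trans h2
  have h4 := hsl_spanFinrank_ofList l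
  generalize ringKrullDim (R ⧸ Ideal.ofList l) = d at *
  generalize (Ideal.ofList l).spanFinrank = f at *
  induction d using WithBot.recBotCoe with
  | bot => simp at h3
  | coe d =>
    induction d using ENat.recTopCoe with
    | top => exact le_top
    | coe d =>
      norm_cast at h3 ⊢
      have h5 : k + l.length ≤ d + f := by exact_mod_cast h3
      exact_mod_cast (by omega : k ≤ d)

lemma hsl_quot_local {R : Type*} [CommRing R] [IsLocalRing R] (I : Ideal R)
    (hI : I ≤ IsLocalRing.maximalIdeal R) :
    ∃ _ : IsLocalRing (R ⧸ I), IsLocalRing.maximalIdeal (R ⧸ I) =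
      (IsLocalRing.maximalIdeal R).map (Ideal.Quotient.mk I) := by
  have : Nontrivial (R ⧸ I) := Ideal.Quotient.nontrivial_iff.2
    (fun h => (IsLocalRing.maximalIdeal.isMaximal R).ne_top (top_le_iff.1 (h ▸ hI)))
  have h := IsLocalRing.of_surjective' (Ideal.Quotient.mk I) Ideal.Quotient.mk_surjective
  refine ⟨h, ?_⟩
  symm
  rcases Ideal.map_eq_top_or_isMaximal_of_surjective (Ideal.Quotient.mk I)
    Ideal.Quotient.mk_surjective (IsLocalRing.maximalIdeal.isMaximal R) with h1 | h1
  · exfalso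
    have h2 := congrArg (Ideal.comap (Ideal.Quotient.mk I)) h1
    rw [Ideal.comap_map_of_surjective _ Ideal.Quotient.mk_surjective, Ideal.comap_top,
      ← RingHom.ker_eq_comap_bot, Ideal.mk_ker, sup_eq_left.2 hI] at h2
    exact (IsLocalRing.maximalIdeal.isMaximal R).ne_top h2
  · exact IsLocalRing.eq_maximalIdeal h1

lemma hsl_exchange {R : Type*} [CommRing R] [IsLocalRing R] (l : List R) :
    ∀ x ∈ Ideal.ofList l, x ∉ IsLocalRing.maximalIdeal R * Ideal.ofList l →
    ∃ l' : List R, l'.length + 1 = l.length ∧ Ideal.ofList l ≤ Ideal.ofList (x :: l') ∧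
      l' ⊆ l := by
  induction l with
  | nil => intro x hx hx'; simp at hx; simp [hx] at hx'
  | cons a l ih =>
    intro x hx hx'
    rw [Ideal.ofList_cons, Submodule.mem_sup] at hx
    obtain ⟨b, hb, y, hy, rfl⟩ := hx
    obtain ⟨r, rfl⟩ := Ideal.mem_span_singleton'.1 hb
    by_cases hr : r ∈ IsLocalRing.maximalIdeal R
    · obtain ⟨l', h1, h2, h3⟩ := ih y hy (fun h => hx' (by
        rw [Ideal.ofList_cons, Ideal.mul_sup]
        exact Submodule.add_mem_sup
          (Ideal.mul_mem_mul hr (Ideal.mem_span_singleton_self _)) h))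
      refine ⟨a :: l', by simp [h1], ?_, by simp [h3, List.subset_cons_of_subset]⟩
      rw [Ideal.ofList_cons]
      refine sup_le ?_ (h2.trans ?_)
      · simp only [Ideal.ofList_cons]
        exact le_sup_of_le_right le_sup_left
      · simp only [Ideal.ofList_cons]
        refine sup_le ?_ (le_sup_of_le_right le_sup_right)
        rw [Ideal.span_singleton_le_iff_mem]
        have : y = (r * a + y) + (- r) * a := by ring
        have h4 : (r * a + y) + (- r) * a ∈ Ideal.span {r * a + y} ⊔ (Ideal.span {a} ⊔
            Ideal.ofList l') := Submodule.add_mem_sup (Ideal.mem_span_singleton_self _)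
          (Submodule.mem_sup_left (Ideal.mul_mem_left _ _ (Ideal.mem_span_singleton_self _)))
        rwa [← this] at h4
    · have hu : IsUnit r := by simpa using hr
      obtain ⟨u, rfl⟩ := hu
      refine ⟨l, by simp, ?_, by simp⟩
      simp only [Ideal.ofList_cons]
      refine sup_le ?_ le_sup_right
      rw [Ideal.span_singleton_le_iff_mem]
      have : a = (↑u⁻¹ : R) * (u * a + y) + (- ↑u⁻¹) * y := by
        rw [mul_add, ← mul_assoc]; simp
      have h4 : (↑u⁻¹ : R) * (u * a + y) + (- ↑u⁻¹) * y ∈ Ideal.span {u * a + y} ⊔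
          Ideal.ofList l := Submodule.add_mem_sup (Ideal.mul_mem_left _ _ (Ideal.mem_span_singleton_self _))
        (Ideal.mul_mem_left _ _ hy)
      rwa [← this] at h4

lemma hsl_domain (n : ℕ) : ∀ (R : Type*) [CommRing R] [IsLocalRing R] [IsNoetherianRing R]
    (l : List R) (_ : Ideal.ofList l = IsLocalRing.maximalIdeal R) (_ : l.length = n)
    (_ : (n : WithBot ℕ∞) ≤ ringKrullDim R), IsDomain R := by
  induction n with
  | zero =>
    intro R _ _ _ l hl hn _
    rw [List.length_eq_zero_iff] at hn
    subst hn
    have : IsField R := IsLocalRing.isField_iff_maximalIdeal_eq.2 (by rw [← hl]; simp)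
    exact this.isDomain
  | succ n ih =>
    intro R _ _ _ l hl hn hdim
    classical
    have hm2 : ¬ IsLocalRing.maximalIdeal R ≤ IsLocalRing.maximalIdeal R ^ 2 := by
      intro h
      have h0 : IsLocalRing.maximalIdeal R = ⊥ := by
        refine Submodule.eq_bot_of_le_smul_of_le_jacobson_bot (IsLocalRing.maximalIdeal R) _
          (IsNoetherian.noetherian _) ?_ ?_
        · rwa [smul_eq_mul, ← pow_two]
        · rw [IsLocalRing.jacobson_eq_maximalIdeal _ bot_ne_top]
      have := hdim.trans (hsl_dim_le (R := R) [] (by rw [h0]; simp))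
      norm_cast at this
    have hmP : ∀ P ∈ minimalPrimes R, ¬ IsLocalRing.maximalIdeal R ≤ P := by
      intro P hP h
      have hPp : P.IsPrime := hP.1.1
      have h0 : P = IsLocalRing.maximalIdeal R := 
        le_antisymm (IsLocalRing.le_maximalIdeal hPp.ne_top) h
      have h1 : P.height = 0 := by
        rwa [Ideal.height_eq_zero_iff]
      rw [← IsLocalRing.maximalIdeal_height_eq_ringKrullDim, ← h0, h1] at hdim
      norm_cast at hdim
    have hfin := minimalPrimes.finite_of_isNoetherianRing R
    have havoid : ∃ x ∈ IsLocalRing.maximalIdeal R, x ∉ IsLocalRing.maximalIdeal R ^ 2 ∧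
        ∀ P ∈ minimalPrimes R, x ∉ P := by
      by_contra hcon
      push Not at hcon
      have := (Ideal.subset_union_prime (I := IsLocalRing.maximalIdeal R)
        (s := insert (IsLocalRing.maximalIdeal R ^ 2) hfin.toFinset) (f := id)
        (IsLocalRing.maximalIdeal R ^ 2) (IsLocalRing.maximalIdeal R ^ 2) (by
          intro i hi hi' _
          simp only [Finset.mem_insert, hi', Set.Finite.mem_toFinset, false_or] at hi
          exact hi.1.1)).1 (by
          intro x hx
          by_cases hx2 : x ∈ IsLocalRing.maximalIdeal R ^ 2
          · exact Set.mem_biUnion (x := IsLocalRing.maximalIdeal R ^ 2) (by simp) hx2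
          · obtain ⟨P, hP, hxP⟩ := hcon x hx hx2
            exact Set.mem_biUnion (x := P) (by simp [hP]) hxP)
      obtain ⟨i, hi, hle⟩ := this
      simp only [Finset.mem_insert, Set.Finite.mem_toFinset] at hi
      rcases hi with rfl | hi
      · exact hm2 hle
      · exact hmP i hi hle
    obtain ⟨x, hx, hx2, hxP⟩ := havoid
    obtain ⟨l', hl', hle, hsub⟩ := hsl_exchange l x (by rwa [hl]) (by rwa [hl, ← pow_two])
    have hxI : Ideal.ofList [x] ≤ IsLocalRing.maximalIdeal R := by
      simpa [Ideal.span_singleton_le_iff_mem] using hx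
    obtain ⟨hloc, hmax⟩ := hsl_quot_local _ hxI
    have hdom : IsDomain (R ⧸ Ideal.ofList [x]) := by
      refine ih _ (l'.map (Ideal.Quotient.mk _)) ?_ (by simp; omega)
        (hsl_dim_quot [x] (by simpa using hx) n (by simpa using hdim))
      rw [hmax, ← Ideal.map_ofList]
      apply le_antisymm
      · apply Ideal.map_mono
        rw [← hl]
        exact Ideal.span_mono fun a ha => hsub ha
      · rw [← hl]
        refine (Ideal.map_mono hle).trans ?_
        have h1 : Ideal.ofList (x :: l') = Ideal.ofList [x] ⊔ Ideal.ofList l' :=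
          Ideal.ofList_append [x] l'
        rw [h1, Ideal.map_sup, Ideal.map_quotient_self, bot_sup_eq]
    have hprime : (Ideal.ofList [x]).IsPrime := (Ideal.Quotient.isDomain_iff_prime _).1 hdom
    obtain ⟨P, hP, hPx⟩ := Ideal.exists_minimalPrimes_le (I := ⊥) (J := Ideal.ofList [x]) bot_le
    have hPp : P.IsPrime := hP.1.1
    have hP0 : P = ⊥ := by
      refine Submodule.eq_bot_of_le_smul_of_le_jacobson_bot (IsLocalRing.maximalIdeal R) _
        (IsNoetherian.noetherian _) ?_ ?_
      · intro y hy
        have h1 := hPx hy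
        rw [Ideal.ofList_singleton, Ideal.mem_span_singleton] at h1
        obtain ⟨r, rfl⟩ := h1
        exact Ideal.mul_mem_mul hx ((hPp.mem_or_mem hy).resolve_left (hxP P hP))
      · rw [IsLocalRing.jacobson_eq_maximalIdeal _ bot_ne_top]
    rw [hP0] at hPp
    exact IsDomain.of_bot_isPrime R
 
lemma hsl_regular {R : Type*} [CommRing R] [IsLocalRing R] [IsNoetherianRing R] (l : List R)
    (hl : Ideal.ofList l = IsLocalRing.maximalIdeal R)
    (hdim : (l.length : WithBot ℕ∞) ≤ ringKrullDim R) :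
    RingTheory.Sequence.IsWeaklyRegular R l := by
  refine ⟨fun k hk => ?_⟩
  have hlm : ∀ a ∈ l, a ∈ IsLocalRing.maximalIdeal R := by
    intro a ha; rw [← hl]; exact Ideal.subset_span ha
  have hIm : Ideal.ofList (l.take k) ≤ IsLocalRing.maximalIdeal R :=
    Ideal.span_le.2 fun a ha => hlm a (List.mem_of_mem_take ha)
  obtain ⟨hloc, hmax⟩ := hsl_quot_local _ hIm
  have hd : ((l.length - k : ℕ) : WithBot ℕ∞) ≤ ringKrullDim (R ⧸ Ideal.ofList (l.take k)) := by
    refine hsl_dim_quot _ (fun a ha => hlm a (List.mem_of_mem_take ha)) _ ?_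
    have : l.length - k + (l.take k).length = l.length := by simp; omega
    rwa [this]
  have hmap : Ideal.ofList ((l.drop k).map (Ideal.Quotient.mk (Ideal.ofList (l.take k)))) =
      IsLocalRing.maximalIdeal (R ⧸ Ideal.ofList (l.take k)) := by
    have h1 : IsLocalRing.maximalIdeal R = Ideal.ofList (l.take k) ⊔ Ideal.ofList (l.drop k) := by
      rw [← Ideal.ofList_append, List.take_append_drop, hl]
    rw [hmax, h1, Ideal.map_sup, Ideal.map_quotient_self, bot_sup_eq, Ideal.map_ofList]
  have hdom : IsDomain (R ⧸ Ideal.ofList (l.take k)) :=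
    hsl_domain _ _ _ hmap (by simp) hd
  have hprime : (Ideal.ofList (l.take k)).IsPrime := (Ideal.Quotient.isDomain_iff_prime _).1 hdom
  have hnot : l[k] ∉ Ideal.ofList (l.take k) := by
    intro hmem
    have h1 := hmap
    rw [List.drop_eq_getElem_cons hk, List.map_cons, Ideal.ofList_cons,
      Ideal.Quotient.eq_zero_iff_mem.2 hmem] at h1
    have h2 := hd.trans (hsl_dim_le _ (by simpa using h1))
    simp only [List.length_map, List.length_drop] at h2
    have h3 : l.length - k ≤ l.length - (k+1) := by exact_mod_cast h2
    omega
  rw [isSMulRegular_quotient_iff_mem_of_smul_mem]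
  intro r hr
  simp only [smul_eq_mul, Ideal.mul_top] at hr ⊢
  exact (hprime.mem_or_mem hr).resolve_left hnot

lemma hsl_regular_pow {R : Type*} [CommRing R] [IsLocalRing R] [IsNoetherianRing R] (q : ℕ)
    (l2 : List R) : ∀ (l1 : List R), (∀ a ∈ l1 ++ l2, a ∈ IsLocalRing.maximalIdeal R) → 0 < q → 
    RingTheory.Sequence.IsWeaklyRegular R (l1 ++ l2) →
    RingTheory.Sequence.IsWeaklyRegular R (l1 ++ l2.map (· ^ q)) := by
  induction l2 with
  | nil => intro l1 _ _ h; simpa using h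
  | cons a l2 ih =>
    intro l1 hm hq h
    have h1 : RingTheory.Sequence.IsWeaklyRegular R ((l1 ++ l2) ++ [a]) :=
      IsLocalRing.isWeaklyRegular_of_perm_of_subset_maximalIdeal h
        (by rw [List.append_assoc]
            exact List.Perm.append_left l1 (List.perm_append_singleton a l2).symm) hm
    rw [RingTheory.Sequence.isWeaklyRegular_append_iff,
      RingTheory.Sequence.isWeaklyRegular_singleton_iff] at h1
    have h2 : RingTheory.Sequence.IsWeaklyRegular R ((l1 ++ l2) ++ [a ^ q]) := by
      rw [RingTheory.Sequence.isWeaklyRegular_append_iff,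
        RingTheory.Sequence.isWeaklyRegular_singleton_iff]
      exact ⟨h1.1, h1.2.pow q⟩
    have hmem : ∀ b ∈ (l1 ++ [a ^ q]) ++ l2, b ∈ IsLocalRing.maximalIdeal R := by
      intro b hb
      simp only [List.append_assoc, List.mem_append, List.mem_singleton] at hb
      rcases hb with hb | rfl | hb
      · exact hm b (by simp [hb])
      · exact Ideal.pow_mem_of_mem _ (hm a (by simp)) _ hq
      · exact hm b (by simp [hb])
    have hperm : List.Perm ((l1 ++ l2) ++ [a ^ q]) ((l1 ++ [a ^ q]) ++ l2) := by
      rw [List.append_assoc, List.append_assoc]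
      exact List.Perm.append_left l1 (List.perm_append_comm)
    have h3 := ih (l1 ++ [a ^ q]) hmem hq
      (IsLocalRing.isWeaklyRegular_of_perm_of_subset_maximalIdeal h2 hperm
        (fun r hr => hmem r (hperm.subset hr)))
    simpa using h3

lemma hsl_mem_ofList {R : Type*} [CommRing R] (x : ℕ → R) (k : ℕ) (r : R) :
    r ∈ Ideal.ofList ((List.range k).map x) ↔
      ∃ b : ℕ → R, r = ∑ i ∈ Finset.range k, b i * x i := by
  induction k generalizing r with
  | zero => simp
  | succ k ih =>
    rw [List.range_succ, List.map_append, Ideal.ofList_append, Submodule.mem_sup]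
    constructor
    · rintro ⟨y, hy, z, hz, rfl⟩
      obtain ⟨b, rfl⟩ := (ih y).1 hy
      simp only [List.map_cons, List.map_nil, Ideal.ofList_singleton] at hz
      obtain ⟨c, rfl⟩ := Ideal.mem_span_singleton'.1 hz
      refine ⟨fun i => if i = k then c else b i, ?_⟩
      rw [Finset.sum_range_succ]
      simp only [if_true]
      congr 1
      refine Finset.sum_congr rfl fun i hi => ?_
      rw [if_neg (by have := Finset.mem_range.1 hi; omega)]
    · rintro ⟨b, rfl⟩
      rw [Finset.sum_range_succ]
      refine ⟨_, (ih _).2 ⟨b, rfl⟩, _, ?_, rfl⟩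
      simp only [List.map_cons, List.map_nil, Ideal.ofList_singleton]
      exact Ideal.mul_mem_left _ _ (Ideal.mem_span_singleton_self _)

/-- Regular sequence data for powers of generators of the maximal ideal. -/
lemma hsl_regular_data {R : Type*} [CommRing R] [IsLocalRing R] [IsNoetherianRing R]
    (s : Finset R) (hs : Ideal.span (s : Set R) = IsLocalRing.maximalIdeal R)
    (hdim : (s.card : WithBot ℕ∞) = ringKrullDim R) (q : ℕ) (hq : 0 < q) :
    ∃ (n : ℕ) (x : ℕ → R), (∀ i, x i ∈ IsLocalRing.maximalIdeal R) ∧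
      (∀ a ∈ IsLocalRing.maximalIdeal R, ∃ b : ℕ → R, a = ∑ i ∈ Finset.range n, b i * x i) ∧
      (∀ k < n, ∀ (r : R) (a : ℕ → R), x k ^ q * r = ∑ i ∈ Finset.range k, a i * x i ^ q →
        ∃ b : ℕ → R, r = ∑ i ∈ Finset.range k, b i * x i ^ q) := by
  classical
  let l := s.toList
  let x : ℕ → R := fun i => l.getD i 0
  have hlx : ∀ f : R → R, (List.range l.length).map (fun i => f (x i)) = l.map f := by
    intro f
    apply List.ext_getElem
    · simp
    · intro i h1 h2
      simp [x, List.getD_eq_getElem?_getD, List.getElem?_eq_getElem (by simpa using h2 : i < l.length)]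
  have hlm : Ideal.ofList l = IsLocalRing.maximalIdeal R := by
    rw [← hs]; simp [Ideal.ofList, l]
  have hmem : ∀ a ∈ l, a ∈ IsLocalRing.maximalIdeal R := by
    intro a ha; rw [← hlm]; exact Ideal.subset_span ha
  have hreg := hsl_regular_pow q l [] (by simpa using hmem) hq
    (hsl_regular l hlm (by simp [l, hdim]))
  refine ⟨l.length, x, fun i => ?_, fun a ha => ?_, fun k hk r a h => ?_⟩
  · by_cases hi : i < l.length
    · exact hmem _ (by simp [x, List.getD_eq_getElem?_getD, List.getElem?_eq_getElem hi])
    · simp [x, List.getD_eq_getElem?_getD, List.getElem?_eq_none (not_lt.1 hi)]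
  · rw [← hsl_mem_ofList]
    have := hlx id
    rw [List.map_id] at this
    simp only [id] at this
    rw [this, hlm]; exact ha
  · rw [← hsl_mem_ofList (fun i => x i ^ q)]
    have h1 := (hsl_mem_ofList (fun i => x i ^ q) k _).2 ⟨a, h⟩
    have h2 := hreg.regular_mod_prev k (by simpa using hk)
    rw [isSMulRegular_quotient_iff_mem_of_smul_mem] at h2
    have h3 : (List.range k).map (fun i => x i ^ q) = ([] ++ l.map (· ^ q)).take k := by
      rw [List.nil_append, ← hlx, ← List.map_take, List.take_range, min_eq_left hk.le]
    have h4 : ([] ++ l.map (· ^ q))[k]'(by simpa using hk) = x k ^ q := by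
      simp [x, List.getD_eq_getElem?_getD, List.getElem?_eq_getElem hk]
    rw [← h3, h4] at h2
    simp only [smul_eq_mul, Ideal.mul_top] at h2
    exact h2 _ h1

lemma hsl_noeth_iff {R N : Type*} [CommRing R] [IsNoetherianRing R] [AddCommGroup N] [Module R N] (I : Ideal R)
    (hart : IsArtinianRing (R ⧸ I)) (h : Module.IsTorsionBySet R N I) :
    IsNoetherian R N ↔ IsArtinian R N := by
  let := h.module
  have hst : IsScalarTower R (R ⧸ I) N := Module.IsTorsionBySet.isScalarTower h
  have h1 : IsNoetherian (R ⧸ I) N ↔ IsArtinian (R ⧸ I) N :=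
    IsSemiprimaryRing.isNoetherian_iff_isArtinian
  have hsurj : Function.Surjective (algebraMap R (R ⧸ I)) := Ideal.Quotient.mk_surjective
  constructor
  · intro h2
    have h3 : IsArtinian (R ⧸ I) N := h1.1 (isNoetherian_of_tower R h2)
    exact isArtinian_of_surjective_algebraMap hsurj
  · intro h2
    have h3 : IsNoetherian (R ⧸ I) N := h1.2 (isArtinian_of_tower R h2)
    have h4 : Module.Finite R N := Module.Finite.trans (R ⧸ I) N
    exact isNoetherian_of_isNoetherianRing_of_finite R N

lemma hsl_art_quot {R : Type*} [CommRing R] [IsLocalRing R] [IsNoetherianRing R] (I : Ideal R)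
    (N : ℕ) (hN : IsLocalRing.maximalIdeal R ^ N ≤ I) : IsArtinianRing (R ⧸ I) := by
  by_cases hI : I = ⊤
  · subst hI
    have : Subsingleton (R ⧸ (⊤ : Ideal R)) := Ideal.Quotient.subsingleton_iff.2 rfl
    infer_instance
  · obtain ⟨_, hmax⟩ := hsl_quot_local I (IsLocalRing.le_maximalIdeal hI)
    rw [isArtinianRing_iff_isNilpotent_maximalIdeal]
    refine ⟨N, ?_⟩
    rw [hmax, ← Ideal.map_pow, Ideal.zero_eq_bot, Ideal.map_eq_bot_iff_le_ker, Ideal.mk_ker]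
    exact hN

lemma hsl_tors {R M : Type*} [CommRing R] [IsLocalRing R] [IsNoetherianRing R]
    [AddCommGroup M] [Module R M] [IsArtinian R M] (x : M) :
    ∃ k : ℕ, ∀ r ∈ IsLocalRing.maximalIdeal R ^ k, r • x = 0 := by
  let f : ℕ →o (Submodule R M)ᵒᵈ :=
    ⟨fun k => OrderDual.toDual (IsLocalRing.maximalIdeal R ^ k • Submodule.span R {x}),
      fun a b hab => Submodule.smul_mono_left (Ideal.pow_le_pow_right hab)⟩
  obtain ⟨k, hk⟩ := monotone_stabilizes_iff_artinian.2 ‹IsArtinian R M› f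
  have h1 : IsLocalRing.maximalIdeal R ^ k • Submodule.span R {x} =
    IsLocalRing.maximalIdeal R ^ (k+1) • Submodule.span R {x} := hk (k+1) (by omega)
  have h0 : IsLocalRing.maximalIdeal R ^ k • Submodule.span R {x} = ⊥ := by
    refine Submodule.eq_bot_of_le_smul_of_le_jacobson_bot (IsLocalRing.maximalIdeal R) _ ?_ ?_ ?_
    · exact Submodule.FG.smul (IsNoetherian.noetherian _) (Submodule.fg_span_singleton x)
    · rw [← mul_smul, ← pow_succ', ← h1]
    · rw [IsLocalRing.jacobson_eq_maximalIdeal _ bot_ne_top]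
  refine ⟨k, fun r hr => ?_⟩
  have := Submodule.smul_mem_smul hr (Submodule.mem_span_singleton_self (R := R) x)
  rwa [h0, Submodule.mem_bot] at this

open TensorProduct in
lemma hsl_T0 {R S M : Type*} [CommRing R] [IsLocalRing R] [IsNoetherianRing R]
    [CommRing S] [IsNoetherianRing S] [Algebra R S]
    [AddCommGroup M] [Module R M] [IsArtinian R M]
    (hm : Function.Injective (LinearMap.rTensor S (IsLocalRing.maximalIdeal R).subtype))
    (hart : IsArtinianRing (S ⧸ (IsLocalRing.maximalIdeal R).map (algebraMap R S))) :
    IsArtinian S (S ⊗[R] M) := by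
  obtain ⟨s, hs⟩ := IsNoetherian.noetherian (IsLocalRing.maximalIdeal R)
  have key := hsl_artin_of_list (P := S) (G := S ⊗[R] M) (s.toList.map (algebraMap R S)) (by
    intro X hX g
    obtain ⟨x, hx, rfl⟩ := List.mem_map.1 hX
    have hxm : x ∈ IsLocalRing.maximalIdeal R := by
      rw [← hs]; exact Submodule.subset_span (by simpa using hx)
    induction g using TensorProduct.induction_on with
    | zero => exact ⟨0, by simp⟩
    | tmul c y =>
      obtain ⟨k, hk⟩ := hsl_tors (R := R) y
      refine ⟨k, ?_⟩
      rw [← map_pow, algebraMap_smul, ← TensorProduct.tmul_smul,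
        hk _ (Ideal.pow_mem_pow hxm k), TensorProduct.tmul_zero]
    | add u v hu hv =>
      obtain ⟨a, ha⟩ := hu
      obtain ⟨b, hb⟩ := hv
      refine ⟨a + b, ?_⟩
      rw [smul_add, pow_add, mul_smul _ _ v, hb, smul_zero, mul_comm, mul_smul, ha, smul_zero,
        add_zero]) ⊤ ?_
  · exact isArtinian_of_linearEquiv Submodule.topEquiv
  · let T := Submodule.torsionBySet R M (IsLocalRing.maximalIdeal R)
    have hTn : IsNoetherian R T := (hsl_noeth_iff (IsLocalRing.maximalIdeal R)
      (hsl_art_quot _ 1 (by simp)) (Submodule.torsionBySet_isTorsionBySet _)).2 inferInstance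
    have hfin : Module.Finite S (S ⊗[R] T) := inferInstance
    have hA : IsArtinian S (S ⊗[R] T) := by
      refine (hsl_noeth_iff _ hart ?_).1 inferInstance
      rw [Ideal.map, Ideal.span, ← Module.isTorsionBySet_iff_is_torsion_by_span]
      rintro g ⟨_, r, hr, rfl⟩
      change algebraMap R S r • g = 0
      induction g using TensorProduct.induction_on with
      | zero => simp
      | tmul c y =>
        have : r • y = 0 := Subtype.ext ((Submodule.mem_torsionBySet_iff _ _).1 y.2 ⟨r, hr⟩)
        rw [algebraMap_smul, ← TensorProduct.tmul_smul, this, TensorProduct.tmul_zero]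
      | add u v hu hv => rw [smul_add, hu, hv, add_zero]
    refine ⟨LinearMap.range (LinearMap.baseChange S T.subtype), inferInstance, ?_⟩
    intro g _ hg
    have hle : Submodule.span R (s : Set R) ≤
        LinearMap.ker (LinearMap.toSpanSingleton R (S ⊗[R] M) g) := by
      rw [Submodule.span_le]
      intro x hx
      have := hg (algebraMap R S x) (List.mem_map.2 ⟨x, by simpa using hx, rfl⟩)
      simpa using this
    obtain ⟨b, hb⟩ := hsl_tors_ker hm (fun x => hsl_tors x) (IsLocalRing.maximalIdeal R) g (by
      intro r hr
      rw [← hs] at hr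
      have := hle hr
      simpa using this)
    exact ⟨b, hb⟩

open TensorProduct in
lemma hsl_T {R S M A : Type*} [CommRing R] [IsLocalRing R] [IsNoetherianRing R]
    [CommRing S] [IsNoetherianRing S] [Algebra R S]
    [AddCommGroup M] [Module R M] [IsArtinian R M]
    [AddCommGroup A] [Module S A]
    (hm : Function.Injective (LinearMap.rTensor S (IsLocalRing.maximalIdeal R).subtype))
    (hart : IsArtinianRing (S ⧸ (IsLocalRing.maximalIdeal R).map (algebraMap R S)))
    (θ : M → A) (hadd : ∀ x y, θ (x + y) = θ x + θ y)
    (hsmul : ∀ (r : R) (x : M), θ (r • x) = algebraMap R S r • θ x)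
    (hspan : Submodule.span S (Set.range θ) = ⊤) :
    ∃ c : ℕ, ∀ t, c ≤ t → ∀ u : A,
      (∀ r ∈ ((IsLocalRing.maximalIdeal R).map (algebraMap R S)) ^ (t - c), r • u = 0) →
      u ∈ Submodule.span S (θ '' {x | ∀ r ∈ IsLocalRing.maximalIdeal R ^ t, r • x = 0}) := by
  have hA := hsl_T0 (M := M) hm hart
  let : Module R A := Module.compHom A (algebraMap R S)
  have : IsScalarTower R S A := ⟨fun r s a => by
    rw [Algebra.smul_def, mul_smul]; rfl⟩
  let θ' : M →ₗ[R] A := { toFun := θ, map_add' := hadd, map_smul' := hsmul }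
  let μ : S ⊗[R] M →ₗ[S] A := θ'.liftBaseChange S
  have hμ : ∀ c y, μ (c ⊗ₜ y) = c • θ y := fun c y => LinearMap.liftBaseChange_tmul S θ' c y
  have hsurj : Function.Surjective μ := by
    rw [← LinearMap.range_eq_top, ← top_le_iff, ← hspan, Submodule.span_le]
    rintro _ ⟨y, rfl⟩
    exact ⟨1 ⊗ₜ y, by rw [hμ, one_smul]⟩
  obtain ⟨c, hc⟩ := hsl_dual_artin_rees ((IsLocalRing.maximalIdeal R).map (algebraMap R S))
    (IsNoetherian.noetherian _) (LinearMap.ker μ)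
  refine ⟨c, fun t ht u hu => ?_⟩
  obtain ⟨a', rfl⟩ := hsurj u
  obtain ⟨k, hk, a, ha, rfl⟩ := hc t ht a' (fun r hr => by
    rw [LinearMap.mem_ker, map_smul]; exact hu r hr)
  rw [map_add, LinearMap.mem_ker.1 hk, zero_add]
  obtain ⟨b, rfl⟩ := hsl_tors_ker hm (fun x => hsl_tors x) (IsLocalRing.maximalIdeal R ^ t) a (by
    intro g hg
    apply ha
    rw [← Ideal.map_pow]
    exact Ideal.mem_map_of_mem _ hg)
  clear ha hu
  induction b using TensorProduct.induction_on with
  | zero => simp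
  | tmul s y =>
    rw [LinearMap.lTensor_tmul, hμ]
    refine Submodule.smul_mem _ _ (Submodule.subset_span ⟨_, ?_, rfl⟩)
    intro r hr
    exact (Submodule.mem_torsionBySet_iff _ _).1 y.2 ⟨r, hr⟩
  | add u v hu hv =>
    rw [map_add, map_add]
    exact Submodule.add_mem _ hu hv

lemma hsl_T_frob {R M : Type*} [CommRing R] [IsLocalRing R] [IsNoetherianRing R]
    [AddCommGroup M] [Module R M] [IsArtinian R M]
    (s : Finset R) (hs : Ideal.span (s : Set R) = IsLocalRing.maximalIdeal R)
    (hdim : (s.card : WithBot ℕ∞) = ringKrullDim R) (q : ℕ) (hq : 0 < q)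
    (φ : R →+* R) (hφ : ∀ r, φ r = r ^ q)
    (θ : M → M) (hadd : ∀ x y, θ (x + y) = θ x + θ y)
    (hsmul : ∀ (r : R) (x : M), θ (r • x) = r ^ q • θ x)
    (hspan : Submodule.span R (Set.range θ) = ⊤) :
    ∃ c : ℕ, ∀ t, c ≤ t → ∀ u : M,
      (∀ r ∈ IsLocalRing.maximalIdeal R ^ (q * (t - c)), r • u = 0) →
      u ∈ Submodule.span R (θ '' {x | ∀ r ∈ IsLocalRing.maximalIdeal R ^ t, r • x = 0}) := by
  obtain ⟨n, x, hxm, hgen, hreg⟩ := hsl_regular_data s hs hdim q hq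
  have hle : (IsLocalRing.maximalIdeal R).map φ ≤ IsLocalRing.maximalIdeal R ^ q := by
    rw [Ideal.map_le_iff_le_comap]
    intro r hr
    rw [Ideal.mem_comap, hφ]
    exact Ideal.pow_mem_pow hr q
  have hart : IsArtinianRing (R ⧸ (IsLocalRing.maximalIdeal R).map φ) := by
    obtain ⟨N, hN⟩ := Ideal.exists_pow_le_of_le_radical_of_fg
      (I := IsLocalRing.maximalIdeal R) (J := (IsLocalRing.maximalIdeal R).map φ) (by
        intro r hr
        refine ⟨q, ?_⟩
        rw [← hφ]
        exact Ideal.mem_map_of_mem _ hr) (IsNoetherian.noetherian _)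
    exact hsl_art_quot _ N hN
  have key : ∃ c : ℕ, ∀ t, c ≤ t → ∀ u : M,
      (∀ r ∈ ((IsLocalRing.maximalIdeal R).map φ) ^ (t - c), r • u = 0) →
      u ∈ Submodule.span R (θ '' {x | ∀ r ∈ IsLocalRing.maximalIdeal R ^ t, r • x = 0}) := by
    have hm := @hsl_max_inj R R _ _ φ.toAlgebra (IsLocalRing.maximalIdeal R) n x hxm hgen (by
      intro k hk r a h
      change φ (x k) * r = ∑ i ∈ Finset.range k, a i * φ (x i) at h
      change ∃ b : ℕ → R, r = ∑ i ∈ Finset.range k, b i * φ (x i)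
      simp only [hφ] at h ⊢
      exact hreg k hk r a h)
    exact @hsl_T R R M M _ _ _ _ _ φ.toAlgebra _ _ _ _ _ hm hart θ hadd
      (fun r y => (hsmul r y).trans (by rw [← hφ]; rfl)) hspan
  obtain ⟨c, hc⟩ := key
  refine ⟨c, fun t ht u hu => hc t ht u (fun r hr => hu r ?_)⟩
  rw [pow_mul]
  exact Ideal.pow_right_mono hle _ hr

lemma hsl_iter {R M : Type*} [CommRing R] [AddCommGroup M] [Module R M] (q : ℕ)
    (θ : M → M) (hadd : ∀ x y, θ (x + y) = θ x + θ y)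
    (hsmul : ∀ (r : R) (x : M), θ (r • x) = r ^ q • θ x) (i : ℕ) :
    (∀ x y, θ^[i] (x + y) = θ^[i] x + θ^[i] y) ∧
    (∀ (r : R) (x : M), θ^[i] (r • x) = r ^ (q ^ i) • θ^[i] x) ∧ θ^[i] 0 = 0 := by
  have h0 : θ 0 = 0 := by
    have := hadd 0 0
    rw [add_zero] at this
    simpa using this
  induction i with
  | zero => simp
  | succ i ih =>
    obtain ⟨h1, h2, h3⟩ := ih
    simp only [Function.iterate_succ_apply']
    refine ⟨fun x y => by rw [h1, hadd], fun r x => ?_, by rw [h3, h0]⟩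
    rw [h2, hsmul, ← pow_mul, pow_succ]

/-- The submodule killed by an iterate. -/
def hslKer {R M : Type*} [CommRing R] [AddCommGroup M] [Module R M] (q : ℕ) (hq : 0 < q)
    (θ : M → M) (hadd : ∀ x y, θ (x + y) = θ x + θ y)
    (hsmul : ∀ (r : R) (x : M), θ (r • x) = r ^ q • θ x) (i : ℕ) : Submodule R M where
  carrier := {x | θ^[i] x = 0}
  add_mem' := by
    intro a b ha hb
    simp only [Set.mem_setOf_eq] at *
    rw [(hsl_iter q θ hadd hsmul i).1, ha, hb, add_zero]
  zero_mem' := (hsl_iter q θ hadd hsmul i).2.2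
  smul_mem' := by
    intro r a ha
    simp only [Set.mem_setOf_eq] at *
    rw [(hsl_iter q θ hadd hsmul i).2.1, ha, smul_zero]

lemma hsl_main {R M : Type*} [CommRing R] [IsLocalRing R] [IsNoetherianRing R]
    [AddCommGroup M] [Module R M] [IsArtinian R M]
    (s : Finset R) (hs : Ideal.span (s : Set R) = IsLocalRing.maximalIdeal R)
    (hdim : (s.card : WithBot ℕ∞) = ringKrullDim R) (q : ℕ) (hq : 2 ≤ q)
    (φ : R →+* R) (hφ : ∀ r, φ r = r ^ q)
    (θ : M → M) (hadd : ∀ x y, θ (x + y) = θ x + θ y)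
    (hsmul : ∀ (r : R) (x : M), θ (r • x) = r ^ q • θ x)
    (hspan : Submodule.span R (Set.range θ) = ⊤)
    (hnil : ∀ x, ∃ i : ℕ, θ^[i] x = 0) : ∀ x : M, x = 0 := by
  have hq0 : 0 < q := by omega
  let K := hslKer q hq0 θ hadd hsmul
  have hK : ∀ i x, x ∈ K i ↔ θ^[i] x = 0 := fun i x => Iff.rfl
  have hKmono : ∀ i j, i ≤ j → K i ≤ K j := by
    intro i j hij x hx
    rw [hK] at hx ⊢
    obtain ⟨k, rfl⟩ := Nat.exists_eq_add_of_le hij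
    rw [add_comm, Function.iterate_add_apply, hx]
    exact (hsl_iter q θ hadd hsmul k).2.2
  obtain ⟨c, hc⟩ := hsl_T_frob s hs hdim q hq0 φ hφ θ hadd hsmul hspan
  let t0 := 2 * c + 1
  let T : ℕ → Submodule R M := fun t =>
    Submodule.torsionBySet R M ((IsLocalRing.maximalIdeal R ^ t : Ideal R) : Set R)
  have hT : ∀ t x, x ∈ T t ↔ ∀ r ∈ IsLocalRing.maximalIdeal R ^ t, r • x = 0 := by
    intro t x
    simp [T, Submodule.mem_torsionBySet_iff]
  have hstep : ∀ t, t0 ≤ t → T (t + 1) ≤ Submodule.span R (θ '' (T t)) := by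
    intro t ht u hu
    have h1 := hc t (by omega) u (by
      intro r hr
      refine (hT _ _).1 hu r (Ideal.pow_le_pow_right ?_ hr)
      have : 2 * (t - c) ≤ q * (t - c) := Nat.mul_le_mul_right _ hq
      omega)
    convert h1 using 3
    ext x
    exact hT t x
  have hfg : (T t0).FG := by
    have : IsNoetherian R (T t0) := (hsl_noeth_iff (IsLocalRing.maximalIdeal R ^ t0)
      (hsl_art_quot _ t0 le_rfl) (Submodule.torsionBySet_isTorsionBySet _)).2 inferInstance
    exact (Submodule.fg_top _).1 (this.noetherian ⊤)
  have hbase : ∃ i, T t0 ≤ K (i + 1) := by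
    obtain ⟨g, hg⟩ := hfg
    choose d hd using hnil
    refine ⟨∑ y ∈ g, d y, ?_⟩
    rw [← hg, Submodule.span_le]
    intro y hy
    exact hKmono (d y) _ ((Finset.single_le_sum (f := d) (fun _ _ => Nat.zero_le _) hy).trans
      (Nat.le_succ _)) (hd y)
  obtain ⟨i, hi⟩ := hbase
  have hall : ∀ j, T (t0 + j) ≤ K (i + 1) := by
    intro j
    induction j with
    | zero => exact hi
    | succ j ih =>
      refine (hstep (t0 + j) (by omega)).trans (le_trans ?_ (hKmono i (i+1) (by omega)))
      rw [Submodule.span_le]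
      rintro _ ⟨y, hy, rfl⟩
      have := ih hy
      rwa [hK, Function.iterate_succ_apply] at this
  have htop : K (i + 1) = ⊤ := by
    rw [eq_top_iff]
    intro x _
    obtain ⟨k, hk⟩ := hsl_tors (R := R) x
    refine hall k ((hT _ _).2 fun r hr => hk r (Ideal.pow_le_pow_right (by omega) hr))
  have hdesc : ∀ j, K j = ⊤ → K 0 = ⊤ := by
    intro j
    induction j with
    | zero => exact id
    | succ j ih =>
      intro h
      apply ih
      rw [eq_top_iff, ← hspan, Submodule.span_le]
      rintro _ ⟨y, rfl⟩
      have : y ∈ K (j + 1) := h ▸ Submodule.mem_top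
      rwa [hK, Function.iterate_succ_apply] at this
  intro x
  have : x ∈ K 0 := hdesc _ htop ▸ Submodule.mem_top
  simpa [hK] using this

theorem hsl_nilpotency (p : ℕ) (hp : p.Prime) (R : Type*) [CommRing R]
    [IsNoetherianRing R] [IsLocalRing R] [CharP R p]
    (hreg : IsRegularLocal R)
    [IsAdicComplete (IsLocalRing.maximalIdeal R) R]
    (M : Type*) [AddCommGroup M] [Module R M] [IsArtinian R M]
    (e : ℕ) (he : 1 ≤ e) (Θ : M → M)
    (hadd : ∀ x y : M, Θ (x + y) = Θ x + Θ y)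
    (hsemi : ∀ (r : R) (x : M), Θ (r • x) = r ^ (p ^ e) • Θ x) :
    ∃ n : ℕ, ∀ x : M, (∃ i : ℕ, Θ^[i] x = 0) → Θ^[n] x = 0 := by
  obtain ⟨s, hs, hdim⟩ := hreg
  have : Fact p.Prime := ⟨hp⟩
  have hq : 2 ≤ p ^ e := hp.two_le.trans (Nat.le_self_pow (by omega) p)
  have hφ : ∀ r : R, iterateFrobenius R p e r = r ^ (p ^ e) := fun r => iterateFrobenius_def p e r
  have hit := hsl_iter (p ^ e) Θ hadd hsemi
  let nil : Set M := {x | ∃ i : ℕ, Θ^[i] x = 0}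
  have hmono : ∀ i j (x : M), i ≤ j → Θ^[i] x = 0 → Θ^[j] x = 0 := by
    intro i j x hij hx
    obtain ⟨k, rfl⟩ := Nat.exists_eq_add_of_le hij
    rw [add_comm, Function.iterate_add_apply, hx]
    exact (hit k).2.2
  let N : Submodule R M :=
    { carrier := nil
      zero_mem' := ⟨0, rfl⟩
      add_mem' := by
        rintro a b ⟨i, hi⟩ ⟨j, hj⟩
        refine ⟨i + j, ?_⟩
        rw [(hit _).1, hmono i _ a (by omega) hi, hmono j _ b (by omega) hj, add_zero]
      smul_mem' := by
        rintro r a ⟨i, hi⟩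
        exact ⟨i, by rw [(hit _).2.1, hi, smul_zero]⟩ }
  have hNΘ : ∀ x ∈ N, Θ x ∈ N := by
    rintro x ⟨i, hi⟩
    refine ⟨i, ?_⟩
    rw [← Function.iterate_succ_apply]
    exact hmono i (i+1) x (by omega) hi
  let W : ℕ → Submodule R M := fun i => Submodule.span R (Θ^[i] '' N)
  have hWN : ∀ i, W i ≤ N := by
    intro i
    refine Submodule.span_le.2 ?_
    rintro _ ⟨x, hx, rfl⟩
    exact (Set.MapsTo.iterate (f := Θ) (s := (N : Set M)) hNΘ i) hx
  have hanti : Antitone W := by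
    refine antitone_nat_of_succ_le fun i => Submodule.span_mono ?_
    rintro _ ⟨x, hx, rfl⟩
    exact ⟨Θ x, hNΘ x hx, rfl⟩
  have hWΘ : ∀ i, ∀ x ∈ W i, Θ x ∈ W (i + 1) := by
    intro i x hx
    induction hx using Submodule.span_induction with
    | mem x hx =>
      obtain ⟨y, hy, rfl⟩ := hx
      refine Submodule.subset_span ⟨y, hy, ?_⟩
      rw [Function.iterate_succ_apply']
    | zero => 
      have := (hit 1).2.2
      simp only [Function.iterate_one] at this
      rw [this]; exact Submodule.zero_mem _
    | add x y _ _ hx hy => rw [hadd]; exact Submodule.add_mem _ hx hy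
    | smul r x _ hx => rw [hsemi]; exact Submodule.smul_mem _ _ hx
  obtain ⟨n, hn⟩ := monotone_stabilizes_iff_artinian.2 ‹IsArtinian R M›
    ⟨fun i => OrderDual.toDual (W i), fun a b hab => hanti hab⟩
  have hn1 : W n = W (n + 1) := hn (n + 1) (by omega)
  let θ : W n → W n := fun x => ⟨Θ x.1, hn1.ge (hWΘ n x.1 x.2)⟩
  have hθi : ∀ i (x : W n), (θ^[i] x).1 = Θ^[i] x.1 := by
    intro i
    induction i with
    | zero => intro x; rfl
    | succ i ih => intro x; rw [Function.iterate_succ_apply, ih, Function.iterate_succ_apply]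
  have hzero := hsl_main s hs hdim (p ^ e) hq (iterateFrobenius R p e) hφ θ
    (fun x y => Subtype.ext (hadd _ _)) (fun r x => Subtype.ext (hsemi _ _))
    (by
      apply Submodule.map_injective_of_injective (W n).injective_subtype
      rw [Submodule.map_span, Submodule.map_top, Submodule.range_subtype]
      apply le_antisymm
      · refine Submodule.span_le.2 ?_
        rintro _ ⟨y, _, rfl⟩
        exact y.2
      · nth_rewrite 1 [hn1]
        refine Submodule.span_mono ?_
        rintro _ ⟨x, hx, rfl⟩
        refine ⟨θ ⟨Θ^[n] x, Submodule.subset_span ⟨x, hx, rfl⟩⟩, ⟨_, rfl⟩, ?_⟩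
        exact (Function.iterate_succ_apply' Θ n x).symm)
    (fun x => by
      obtain ⟨i, hi⟩ := hWN n x.2
      exact ⟨i, Subtype.ext (by rw [hθi, hi]; rfl)⟩)
  refine ⟨n, fun x hx => ?_⟩
  have := hzero ⟨Θ^[n] x, Submodule.subset_span ⟨x, hx, rfl⟩⟩
  exact congrArg Subtype.val this
end

section
/- Let A = K[x₁,…,xₙ] be a polynomial ring over a field K of prime characteristic p, let P be a prime ideal of A, and let Â denote the P-adic completion of A. Let J be an ideal of A and e ≥ 1, and suppose L₀ is the smallest ideal of A (with respect to inclusion) such that J ⊆ L₀^{[p^e]}, i.e. L₀ = I_e(J). Then the extension L₀Â of L₀ along the canonical map A → Â is the smallest ideal L of Â such that JÂ ⊆ L^{[p^e]}; in other words, I_e(JÂ) exists and I_e(JÂ) = I_e(J)Â. -/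
/-- The `e`-th Frobenius power `L^{[p^e]}` of an ideal `L`: the ideal generated by
the `p^e`-th powers of the elements of `L`. -/
def frobeniusPower {R : Type*} [CommRing R] (p e : ℕ) (L : Ideal R) : Ideal R :=
  Ideal.span ((fun a => a ^ p ^ e) '' (L : Set R))

theorem frobeniusPower_eq_map {R : Type*} [CommRing R] (p e : ℕ) [Fact p.Prime] [CharP R p]
    (L : Ideal R) : frobeniusPower p e L = L.map (iterateFrobenius R p e) := by
  unfold frobeniusPower Ideal.map
  congr 1

theorem frobeniusPower_map {R S : Type*} [CommRing R] [CommRing S] (p e : ℕ) [Fact p.Prime]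
    [CharP R p] [CharP S p] (f : R →+* S) (L : Ideal R) :
    frobeniusPower p e (L.map f) = (frobeniusPower p e L).map f := by
  rw [frobeniusPower_eq_map, frobeniusPower_eq_map, Ideal.map_map, Ideal.map_map]
  congr 1
  ext x
  simp [iterateFrobenius_def]

theorem frobeniusPower_mono {R : Type*} [CommRing R] (p e : ℕ) {L M : Ideal R} (h : L ≤ M) :
    frobeniusPower p e L ≤ frobeniusPower p e M :=
  Ideal.span_mono (Set.image_mono h)

theorem mem_map_pow_of_evala {R : Type*} [CommRing R] {I : Ideal R} (hI : I.FG) (n : ℕ)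
    {x : AdicCompletion I R} (hx : AdicCompletion.evalₐ I n x = 0) :
    x ∈ (I ^ n).map (algebraMap R (AdicCompletion I R)) := by
  have h1 : x ∈ (AdicCompletion.eval I R n).ker := by
    rw [LinearMap.mem_ker, ← AdicCompletion.factor_evalₐ_eq_eval I x (Ideal.mul_top _).ge, hx, map_zero]
  rw [← AdicCompletion.pow_smul_top_eq_ker_eval hI, Ideal.smul_top_eq_map] at h1
  exact h1

theorem exists_approx {R : Type*} [CommRing R] {I : Ideal R} (hI : I.FG) (n : ℕ)
    (x : AdicCompletion I R) :
    ∃ r : R, x - algebraMap R _ r ∈ (I ^ n).map (algebraMap R (AdicCompletion I R)) := by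
  obtain ⟨r, hr⟩ := Ideal.Quotient.mk_surjective (AdicCompletion.evalₐ I n x)
  refine ⟨r, mem_map_pow_of_evala hI n ?_⟩
  rw [map_sub, ← hr, sub_eq_zero]
  exact ((AdicCompletion.evalₐ I n).commutes r).symm

theorem comap_map_le {R : Type*} [CommRing R] {I N : Ideal R} (n : ℕ) (h : I ^ n ≤ N) :
    (N.map (algebraMap R (AdicCompletion I R))).comap (algebraMap R (AdicCompletion I R)) ≤ N := by
  intro r hr
  have h1 := Ideal.mem_map_of_mem (AdicCompletion.evalₐ I n : AdicCompletion I R →+* R ⧸ I ^ n)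
    (Ideal.mem_comap.mp hr)
  rw [Ideal.map_map] at h1
  have h2 : (AdicCompletion.evalₐ I n : AdicCompletion I R →+* R ⧸ I ^ n).comp
      (algebraMap R (AdicCompletion I R)) = Ideal.Quotient.mk (I ^ n) := by
    ext x
    exact (AdicCompletion.evalₐ I n).commutes x
  have h3 : (AdicCompletion.evalₐ I n : AdicCompletion I R →+* R ⧸ I ^ n)
      (algebraMap R (AdicCompletion I R) r) = Ideal.Quotient.mk (I ^ n) r :=
    (AdicCompletion.evalₐ I n).commutes r
  rw [h2, h3, ← Ideal.mem_comap, Ideal.comap_map_of_surjective _ Ideal.Quotient.mk_surjective,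
    ← RingHom.ker_eq_comap_bot, Ideal.mk_ker, sup_eq_left.mpr h] at h1
  exact h1

theorem isNoetherianRing_adicCompletion {R : Type*} [CommRing R] [IsNoetherianRing R]
    (I : Ideal R) : IsNoetherianRing (AdicCompletion I R) := by
  have hI : I.FG := IsNoetherian.noetherian I
  obtain ⟨s, hs⟩ := id hI
  let B := MvPolynomial s R
  let J : Ideal B := MvPolynomial.idealOfVars s R
  let φ : B →+* R := (MvPolynomial.aeval (fun i : s => (i : R)) : B →ₐ[R] R).toRingHom
  have hφC : ∀ r : R, φ (MvPolynomial.C r) = r := fun r => MvPolynomial.aeval_C _ r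
  have hφX : ∀ i : s, φ (MvPolynomial.X i) = (i : R) := fun i => MvPolynomial.aeval_X _ i
  have hJ : J.map φ = I := by
    simp only [J, MvPolynomial.idealOfVars, Ideal.map_span, ← Set.range_comp]
    rw [← hs]
    congr 1
    ext x
    simp [hφX]
  have hle : ∀ n, J ^ n ≤ (I ^ n).comap φ := fun n => by
    rw [← Ideal.map_le_iff_le_comap, Ideal.map_pow, hJ]
  let f : (n : ℕ) → AdicCompletion J B →+* R ⧸ I ^ n := fun n =>
    (Ideal.quotientMap (I ^ n) φ (hle n)).comp
      (AdicCompletion.evalₐ J n : AdicCompletion J B →+* B ⧸ J ^ n)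
  have hfa : ∀ n (b : B), f n (algebraMap B _ b) = Ideal.Quotient.mk _ (φ b) := by
    intro n b
    have : (AdicCompletion.evalₐ J n) (algebraMap B _ b) = Ideal.Quotient.mk _ b :=
      (AdicCompletion.evalₐ J n).commutes b
    simp only [f, RingHom.comp_apply, RingHom.coe_coe, this, Ideal.quotientMap_mk]
  have hf : ∀ {m n : ℕ} (h : m ≤ n), (Ideal.Quotient.factorPow I h).comp (f n) = f m := by
    intro m n h
    ext x
    obtain ⟨b, hb⟩ := exists_approx (MvPolynomial.idealOfVars_fg s R) n x
    have key : ∀ k ≤ n, f k x = Ideal.Quotient.mk _ (φ b) := by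
      intro k hk
      rw [← hfa, ← sub_eq_zero, ← map_sub, ← RingHom.mem_ker]
      refine (Ideal.map_le_iff_le_comap.mpr ?_ : _ ≤ RingHom.ker (f k)) hb
      intro c hc
      rw [Ideal.mem_comap, RingHom.mem_ker, hfa, Ideal.Quotient.eq_zero_iff_mem]
      exact Ideal.pow_le_pow_right hk (hle n hc)
    rw [RingHom.comp_apply, key n le_rfl, key m h]
    rfl
  let F := AdicCompletion.liftRingHom I f hf
  have hF : F.comp (algebraMap B _) = (algebraMap R _).comp φ := by
    refine RingHom.ext fun b => ?_
    refine AdicCompletion.ext_evalₐ fun n => ?_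
    simp only [F, RingHom.comp_apply, AdicCompletion.evalₐ_liftRingHom, hfa]
    exact ((AdicCompletion.evalₐ I n).commutes _).symm
  have hmap : (J.map (algebraMap B (AdicCompletion J B))).map F =
      I.map (algebraMap R (AdicCompletion I R)) := by
    rw [Ideal.map_map, hF, ← Ideal.map_map, hJ]
  have c1 := AdicCompletion.isAdicComplete_self J (MvPolynomial.idealOfVars_fg s R)
  have c2 := AdicCompletion.isAdicComplete_self I hI
  have c3 : IsHausdorff ((J.map (algebraMap B (AdicCompletion J B))).map F)
      (AdicCompletion I R) := by rw [hmap]; infer_instance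
  have hsurj : Function.Surjective F := by
    refine surjective_of_mk_map_comp_surjective (I := J.map (algebraMap B (AdicCompletion J B)))
      F ?_
    intro y
    obtain ⟨x, rfl⟩ := Ideal.Quotient.mk_surjective y
    obtain ⟨r, hr⟩ := exists_approx hI 1 x
    refine ⟨algebraMap B _ (MvPolynomial.C r), ?_⟩
    rw [RingHom.comp_apply, eq_comm, Ideal.Quotient.eq, hmap]
    have h1 : F (algebraMap B _ (MvPolynomial.C r)) = algebraMap R _ r := by
      rw [← RingHom.comp_apply, hF]
      rw [RingHom.comp_apply, hφC]
    rw [h1]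
    simpa using hr
  have : IsNoetherianRing (MvPowerSeries s R) := inferInstance
  have : IsNoetherianRing (AdicCompletion J B) :=
    isNoetherianRing_of_ringEquiv _ (MvPowerSeries.toAdicCompletionAlgEquiv s R).toRingEquiv
  exact isNoetherianRing_of_surjective _ _ F hsurj

theorem closed_ideal {R : Type*} [CommRing R] [IsNoetherianRing R] (I : Ideal R)
    (L : Ideal (AdicCompletion I R)) (x : AdicCompletion I R)
    (hx : ∀ m, x ∈ L ⊔ (I ^ m).map (algebraMap R (AdicCompletion I R))) : x ∈ L := by
  have hN := isNoetherianRing_adicCompletion I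
  have hc := AdicCompletion.isAdicComplete_self I (IsNoetherian.noetherian I)
  have hH := IsHausdorff.of_le_jacobson (I.map (algebraMap R (AdicCompletion I R)))
    (AdicCompletion I R ⧸ L) (IsAdicComplete.le_jacobson_bot _)
  rw [← Ideal.Quotient.eq_zero_iff_mem]
  refine hH.haus _ fun m => ?_
  rw [SModEq.zero, ← Ideal.map_pow]
  obtain ⟨l, hl, y, hy, rfl⟩ := Submodule.mem_sup.mp (hx m)
  rw [map_add, Ideal.Quotient.eq_zero_iff_mem.mpr hl, zero_add]
  have : Ideal.Quotient.mk L y = y • (1 : AdicCompletion I R ⧸ L) := by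
    rw [Algebra.smul_def, mul_one]; rfl
  rw [this]
  exact Submodule.smul_mem_smul hy trivial

theorem Ie_minimal {R : Type*} [CommRing R] [IsNoetherianRing R] (I : Ideal R) (p e : ℕ)
    [Fact p.Prime] [CharP R p] [CharP (AdicCompletion I R) p] (J L₀ : Ideal R)
    (h₂ : ∀ L : Ideal R, J ≤ frobeniusPower p e L → L₀ ≤ L)
    (L : Ideal (AdicCompletion I R))
    (hL : J.map (algebraMap R (AdicCompletion I R)) ≤ frobeniusPower p e L) :
    L₀.map (algebraMap R (AdicCompletion I R)) ≤ L := by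
  rw [Ideal.map_le_iff_le_comap]
  intro x hx
  refine closed_ideal I L _ fun m => ?_
  set L' := L ⊔ (I ^ m).map (algebraMap R (AdicCompletion I R)) with hL'
  set M := L'.comap (algebraMap R (AdicCompletion I R)) with hM
  have hIM : I ^ m ≤ M := Ideal.map_le_iff_le_comap.mp le_sup_right
  have hML : L' ≤ M.map (algebraMap R (AdicCompletion I R)) := by
    intro y hy
    obtain ⟨r, hr⟩ := exists_approx (IsNoetherian.noetherian I) m y
    have hrM : r ∈ M := by
      rw [hM, Ideal.mem_comap]
      have := L'.sub_mem hy ((le_sup_right : _ ≤ L') hr)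
      simpa using this
    have := (M.map (algebraMap R (AdicCompletion I R))).add_mem (Ideal.map_mono hIM hr)
      (Ideal.mem_map_of_mem _ hrM)
    simpa using this
  have hrad : I ^ m ≤ (frobeniusPower p e M).radical := fun a ha =>
    ⟨p ^ e, Ideal.subset_span ⟨a, hIM ha, rfl⟩⟩
  obtain ⟨k, hk⟩ := Ideal.exists_pow_le_of_le_radical_of_fg hrad (IsNoetherian.noetherian _)
  rw [← pow_mul] at hk
  refine h₂ M (le_trans ?_ (comap_map_le _ hk)) hx
  rw [← Ideal.map_le_iff_le_comap, ← frobeniusPower_map]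
  exact hL.trans (frobeniusPower_mono p e (le_sup_left.trans hML))

/-- Let `A = K[x₁, …, xₙ]` be a polynomial ring over a field `K` of prime
characteristic `p`, let `P ⊆ A` be a prime ideal and `Â` the `P`-adic completion
of `A`. Let `J ⊆ A` be an ideal and `e ≥ 1`. If `L₀ = I_e(J)` is the smallest
ideal of `A` whose `e`-th Frobenius power contains `J`, then the extension `L₀Â`
is the smallest ideal `L` of `Â` with `JÂ ⊆ L^{[p^e]}`; that is, `I_e(JÂ)` exists
and equals `I_e(J)Â`. -/
theorem Ie_adicCompletion (p n : ℕ) (hp : p.Prime)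
    (K : Type*) [Field K] [CharP K p]
    (P : Ideal (MvPolynomial (Fin n) K)) (hP : P.IsPrime)
    (J : Ideal (MvPolynomial (Fin n) K))
    (e : ℕ) (he : 1 ≤ e) (L₀ : Ideal (MvPolynomial (Fin n) K))
    (h₁ : J ≤ frobeniusPower p e L₀)
    (h₂ : ∀ L : Ideal (MvPolynomial (Fin n) K), J ≤ frobeniusPower p e L → L₀ ≤ L) :
    J.map (algebraMap (MvPolynomial (Fin n) K)
            (AdicCompletion P (MvPolynomial (Fin n) K))) ≤
        frobeniusPower p e
          (L₀.map (algebraMap (MvPolynomial (Fin n) K)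
            (AdicCompletion P (MvPolynomial (Fin n) K)))) ∧
      ∀ L : Ideal (AdicCompletion P (MvPolynomial (Fin n) K)),
        J.map (algebraMap (MvPolynomial (Fin n) K)
            (AdicCompletion P (MvPolynomial (Fin n) K))) ≤
          frobeniusPower p e L →
        L₀.map (algebraMap (MvPolynomial (Fin n) K)
            (AdicCompletion P (MvPolynomial (Fin n) K))) ≤ L := by
  have : Fact p.Prime := ⟨hp⟩
  have : Nontrivial (AdicCompletion P (MvPolynomial (Fin n) K)) := by
    have : Nontrivial (MvPolynomial (Fin n) K ⧸ P) := Ideal.Quotient.nontrivial_iff.mpr hP.ne_top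
    exact (AdicCompletion.evalOneₐ P).toRingHom.domain_nontrivial
  have : CharP (AdicCompletion P (MvPolynomial (Fin n) K)) p :=
    charP_of_injective_ringHom
      ((algebraMap (MvPolynomial (Fin n) K)
        (AdicCompletion P (MvPolynomial (Fin n) K))).comp MvPolynomial.C).injective p
  refine ⟨?_, fun L hL => Ie_minimal P p e J L₀ h₂ L hL⟩
  rw [frobeniusPower_map]
  exact Ideal.map_mono h₁
end
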